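/- arXiv:1402.3142 — 2 statements merged into one kernel-verified Lean document; each statement's English description precedes it below -/
import Mathlib

section
/- Let C be a class of (finite simple) graphs and let p be a positive integer. If log(Ex_C(r))/r ≤ 1/(10(p+1)) holds for every positive integer r (natural logarithm), then there is an integer g such that every graph G ∈ C with girth at least g satisfies χ_p(G) ≤ p + 2. -/
open SimpleGraph ENNReal

universe u

/-- `H` is a shallow minor of `G` at depth `r`: there are pairwise disjoint branch sets
`A i ⊆ V(G)`, each inducing a connected subgraph of radius at most `r` (witnessed by a
center joined to every vertex of the branch set by a walk of length at most `r` inside it),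
such that adjacency in `H` is witnessed by an edge of `G` between the branch sets. -/
def SimpleGraph.IsShallowMinor {V : Type u} (G : SimpleGraph V) (r : ℕ)
    {h : ℕ} (H : SimpleGraph (Fin h)) : Prop :=
  ∃ A : Fin h → Set V,
    (Pairwise fun i j => Disjoint (A i) (A j)) ∧
    (∀ i, ∃ c : A i, ∀ v : A i, ∃ w : (G.induce (A i)).Walk c v, w.length ≤ r) ∧
    (∀ i j, H.Adj i j → ∃ a ∈ A i, ∃ b ∈ A j, G.Adj a b)

/-- The grad (greatest reduced average density) `∇_r(G)`: supremum of `‖H‖/|H|` over the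
shallow minors `H` of `G` at depth `r`. -/
noncomputable def SimpleGraph.nabla {V : Type u} (G : SimpleGraph V) (r : ℕ) : ℝ≥0∞ :=
  sSup {x : ℝ≥0∞ | ∃ (h : ℕ) (H : SimpleGraph (Fin h)), 0 < h ∧ G.IsShallowMinor r H ∧
    x = (Nat.card H.edgeSet : ℝ≥0∞) / (h : ℝ≥0∞)}

/-- A class of finite simple graphs, presented as a set of graphs on `Fin n` for varying `n`. -/
abbrev GraphClass : Type := Set ((n : ℕ) × SimpleGraph (Fin n))

/-- The expansion `Ex_C(r) = sup { ∇_r(G) : G ∈ C }` of a class of graphs. -/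
noncomputable def GraphClass.expansion (C : GraphClass) (r : ℕ) : ℝ≥0∞ :=
  sSup {x : ℝ≥0∞ | ∃ G ∈ C, x = SimpleGraph.nabla G.2 r}

/-- Iterated deletion of internal vertices of long induced-degree-two paths, ending in a
forest.  `PathDegen G p H` means the subgraph `H` of `G` can be reduced to a forest by
repeatedly deleting the internal vertices (all of degree two) of a path of length at
least `p`. -/
inductive SimpleGraph.PathDegen {V : Type u} (G : SimpleGraph V) (p : ℕ) : G.Subgraph → Prop
  | forest (H : G.Subgraph) (hH : H.coe.IsAcyclic) : PathDegen G p H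
  | step (H : G.Subgraph) (l : List V) (hnd : l.Nodup)
      (hchain : l.Chain' H.Adj) (hlen : p + 1 ≤ l.length)
      (hdeg : ∀ v ∈ l.tail.dropLast, (H.neighborSet v).ncard = 2)
      (hrec : PathDegen G p (H.deleteVerts {v | v ∈ l.tail.dropLast})) :
      PathDegen G p H

/-- A graph is `p`-path degenerate if it can be reduced to a forest by repeatedly deleting
the internal vertices, all of degree two, of paths of length at least `p`. -/
def SimpleGraph.IsPathDegenerate {V : Type u} (G : SimpleGraph V) (p : ℕ) : Prop :=
  G.PathDegen p ⊤

/-- A circular `(n,k)`-coloring: a map to `ℤ_n` sending adjacent vertices to elements at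
circular distance at least `k`. -/
def SimpleGraph.IsCircularColoring {V : Type u} (G : SimpleGraph V) (n k : ℕ) : Prop :=
  ∃ f : V → ZMod n, ∀ u v, G.Adj u v → k ≤ (f u - f v).val ∧ (f u - f v).val ≤ n - k

/-- The circular chromatic number: the infimum of the rationals `n/k` such that `G` has a
circular `(n,k)`-coloring. -/
noncomputable def SimpleGraph.circChromNum {V : Type u} (G : SimpleGraph V) : ℝ :=
  sInf {x : ℝ | ∃ n k : ℕ, 0 < n ∧ 0 < k ∧ G.IsCircularColoring n k ∧ x = (n : ℝ) / (k : ℝ)}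

/-- `o` is an orientation of `G`: every arc of `o` is an edge of `G`, and every edge of `G`
gets exactly one of its two possible directions. -/
def SimpleGraph.IsOrientation {V : Type u} (G : SimpleGraph V) (o : V → V → Prop) : Prop :=
  (∀ u v, o u v → G.Adj u v) ∧ (∀ u v, G.Adj u v → (o u v ↔ ¬ o v u))

/-- The oriented chromatic number: the least `k` such that every orientation of `G` admits a
homomorphism into some loopless digraph on `k` vertices. -/
noncomputable def SimpleGraph.orientedChromNum {V : Type u} (G : SimpleGraph V) : ℕ :=
  sInf {k : ℕ | ∀ o : V → V → Prop, G.IsOrientation o →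
    ∃ D : Fin k → Fin k → Prop, Irreflexive D ∧
      ∃ f : V → Fin k, ∀ u v, o u v → D (f u) (f v)}

/-- The circulant digraph `C⃗_n^d`: vertex set `ℤ_n`, with an arc `(i,j)` whenever
`j - i ∈ {1, …, d}` (mod `n`). -/
def circulantDigraph (n d : ℕ) : ZMod n → ZMod n → Prop :=
  fun i j => ∃ s : ℕ, 1 ≤ s ∧ s ≤ d ∧ j - i = (s : ZMod n)

/-- Tree-depth of `G`: the minimum height of a rooted forest (encoded as a strict partial
order on the vertices in which the set of strict ancestors of any vertex is a chain) all of
whose chains have at most `k` vertices, such that every edge of `G` joins two comparable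
vertices. -/
noncomputable def SimpleGraph.treeDepth {V : Type u} [Fintype V] (G : SimpleGraph V) : ℕ :=
  sInf {k : ℕ | ∃ lt : V → V → Prop, Transitive lt ∧ Irreflexive lt ∧
    (∀ x y z, lt x z → lt y z → (lt x y ∨ lt y x ∨ x = y)) ∧
    (∀ u v, G.Adj u v → lt u v ∨ lt v u) ∧
    (∀ s : Finset V, (∀ x ∈ s, ∀ y ∈ s, x = y ∨ lt x y ∨ lt y x) → s.card ≤ k)}

/-- The `p`-th chromatic number `χ_p(G)`: the least `N` such that `G` has a vertex coloring
with `N` colors in which, for every `i ≤ p`, the union of any `i` color classes induces a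
subgraph of tree-depth at most `i`. -/
noncomputable def SimpleGraph.chiP {V : Type u} [Fintype V] (G : SimpleGraph V) (p : ℕ) : ℕ :=
  sInf {N : ℕ | ∃ c : V → Fin N, ∀ i : ℕ, i ≤ p → ∀ s : Finset (Fin N), s.card = i →
    (G.induce {v | c v ∈ s}).treeDepth ≤ i}

/-- A `p`-centered coloring: every connected induced subgraph either has a color appearing
exactly once in it, or receives at least `p` distinct colors. -/
def SimpleGraph.IsCenteredColoring {V : Type u} (G : SimpleGraph V) (p : ℕ)
    {N : ℕ} (c : V → Fin N) : Prop :=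
  ∀ s : Set V, (G.induce s).Connected →
    (∃ col : Fin N, {v ∈ s | c v = col}.ncard = 1) ∨ p ≤ (c '' s).ncard

/-- `H` is a minor of `G`: there are pairwise disjoint branch sets, each inducing a
connected subgraph of `G`, such that adjacency in `H` is witnessed by an edge of `G`
between the corresponding branch sets. -/
def SimpleGraph.IsMinor {V : Type u} (G : SimpleGraph V) {h : ℕ} (H : SimpleGraph (Fin h)) : Prop :=
  ∃ A : Fin h → Set V,
    (Pairwise fun i j => Disjoint (A i) (A j)) ∧
    (∀ i, (G.induce (A i)).Connected) ∧
    (∀ i j, H.Adj i j → ∃ a ∈ A i, ∃ b ∈ A j, G.Adj a b)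

/-- A minor-closed class of graphs. -/
def GraphClass.MinorClosed (C : GraphClass) : Prop :=
  ∀ G ∈ C, ∀ (h : ℕ) (H : SimpleGraph (Fin h)), (Sigma.snd G).IsMinor H → ⟨h, H⟩ ∈ C

/-- The clique-grad `ω_r(G)`: the maximum clique number over the shallow minors of `G`
at depth `r`. -/
noncomputable def SimpleGraph.omegaMinor {V : Type u} (G : SimpleGraph V) (r : ℕ) : ℕ :=
  sSup {k : ℕ | ∃ (h : ℕ) (H : SimpleGraph (Fin h)), G.IsShallowMinor r H ∧
    ∃ s : Finset (Fin h), H.IsNClique k s}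

namespace SimpleGraph

/-- A finite vertex set is connected: it has no proper nonempty part closed under adjacency. -/
def ConnectedOn {V : Type*} (G : SimpleGraph V) (A : Finset V) : Prop :=
  ∀ B ⊆ A, B.Nonempty → (∀ b ∈ B, ∀ a ∈ A, G.Adj b a → a ∈ B) → B = A

/-- If every connected set with at most `p` colors has a uniquely colored vertex, then every set
with at most `p` colors carries a forest order whose chains are no longer than its number of
colors. -/
theorem exists_forest_order {V ι : Type*} [DecidableEq V] [DecidableEq ι] (G : SimpleGraph V)
    (c : V → ι) (p : ℕ)
    (hc : ∀ A : Finset V, A.Nonempty → G.ConnectedOn A → (A.image c).card ≤ p →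
      ∃ a ∈ A, ∀ b ∈ A, c b = c a → b = a) (U : Finset V) :
    (U.image c).card ≤ p → ∃ lt : V → V → Prop,
      (∀ x y, lt x y → x ∈ U ∧ y ∈ U) ∧ (∀ x y z, lt x y → lt y z → lt x z) ∧ (∀ x, ¬ lt x x) ∧
      (∀ x y z, lt x z → lt y z → (lt x y ∨ lt y x ∨ x = y)) ∧
      (∀ u ∈ U, ∀ v ∈ U, G.Adj u v → lt u v ∨ lt v u) ∧
      (∀ s ⊆ U, (∀ x ∈ s, ∀ y ∈ s, x = y ∨ lt x y ∨ lt y x) → s.card ≤ (U.image c).card) := by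
  induction U using Finset.strongInduction with
  | H U ih =>
  intro hU
  rcases U.eq_empty_or_nonempty with rfl | hne
  · refine ⟨fun _ _ => False, by simp, by simp, by simp,
      by simp, by simp, ?_⟩
    intro s hs _
    simp [Finset.subset_empty.mp hs]
  by_cases hconn : G.ConnectedOn U
  · obtain ⟨a, haU, ha⟩ := hc U hne hconn hU
    have himg : (U.erase a).image c ⊆ (U.image c).erase (c a) := by
      intro x hx
      obtain ⟨b, hb, rfl⟩ := Finset.mem_image.mp hx
      rw [Finset.mem_erase] at hb ⊢
      exact ⟨fun h => hb.1 (ha b hb.2 h), Finset.mem_image_of_mem _ hb.2⟩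
    have hcard : ((U.erase a).image c).card + 1 ≤ (U.image c).card := by
      have h1 := Finset.card_le_card himg
      have h2 := Finset.card_erase_add_one (Finset.mem_image_of_mem c haU)
      omega
    obtain ⟨lt, hmem, htr, hirr, hch, hedge, hsz⟩ :=
      ih (U.erase a) (Finset.erase_ssubset haU) (by omega)
    have hna : ∀ x, ¬ lt x a := fun x hx => by simpa using (hmem x a hx).2
    have hna' : ∀ x, ¬ lt a x := fun x hx => by simpa using (hmem a x hx).1
    refine ⟨fun x y => (x = a ∧ y ∈ U.erase a) ∨ lt x y, ?_, ?_, ?_, ?_, ?_, ?_⟩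
    · rintro x y (⟨rfl, h⟩ | h)
      · exact ⟨haU, Finset.mem_of_mem_erase h⟩
      · exact ⟨Finset.mem_of_mem_erase (hmem x y h).1, Finset.mem_of_mem_erase (hmem x y h).2⟩
    · rintro x y z (⟨rfl, h⟩ | h) (⟨rfl, h'⟩ | h')
      · exact Or.inl ⟨rfl, h'⟩
      · exact Or.inl ⟨rfl, (hmem _ _ h').2⟩
      · exact absurd h (hna _)
      · exact Or.inr (htr _ _ _ h h')
    · rintro x (⟨rfl, h⟩ | h)
      · simp at h
      · exact hirr x h
    · rintro x y z (⟨rfl, h⟩ | h) (⟨rfl, h'⟩ | h')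
      · exact Or.inr (Or.inr rfl)
      · exact Or.inl (Or.inl ⟨rfl, (hmem _ _ h').1⟩)
      · exact Or.inr (Or.inl (Or.inl ⟨rfl, (hmem _ _ h).1⟩))
      · rcases hch x y z h h' with h | h | h <;> simp [h]
    · intro u hu v hv huv
      by_cases hua : u = a
      · exact Or.inl (Or.inl ⟨hua, Finset.mem_erase.mpr ⟨fun h => huv.ne (hua.trans h.symm), hv⟩⟩)
      by_cases hva : v = a
      · exact Or.inr (Or.inl ⟨hva, Finset.mem_erase.mpr ⟨hua, hu⟩⟩)
      rcases hedge u (by simp [hua, hu]) v (by simp [hva, hv]) huv with h | h <;> simp [h]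
    · intro s hs hcomp
      have h1 := hsz (s.erase a) (Finset.erase_subset_erase a hs) (by
        intro x hx y hy
        rw [Finset.mem_erase] at hx hy
        simpa [hx.1, hy.1] using hcomp x hx.2 y hy.2)
      have h2 := Finset.pred_card_le_card_erase (s := s) (a := a)
      omega
  · unfold ConnectedOn at hconn
    push Not at hconn
    obtain ⟨B, hBU, hBne, hcl, hne'⟩ := hconn
    have hcl' : ∀ x ∈ U \ B, ∀ y ∈ B, ¬ G.Adj y x := by
      intro x hx y hy h
      rw [Finset.mem_sdiff] at hx
      exact hx.2 (hcl y hy x hx.1 h)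
    have hmono : ∀ {S : Finset V}, S ⊆ U → (S.image c).card ≤ (U.image c).card :=
      fun h => Finset.card_le_card (Finset.image_subset_image h)
    obtain ⟨lt₁, hmem₁, htr₁, hirr₁, hch₁, hedge₁, hsz₁⟩ :=
      ih B (hBU.ssubset_of_ne hne') ((hmono hBU).trans hU)
    obtain ⟨lt₂, hmem₂, htr₂, hirr₂, hch₂, hedge₂, hsz₂⟩ :=
      ih (U \ B) (Finset.sdiff_ssubset hBU hBne) ((hmono Finset.sdiff_subset).trans hU)
    have hdis : ∀ {x}, x ∈ B → x ∈ U \ B → False := by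
      intro x h h'
      exact (Finset.mem_sdiff.mp h').2 h
    refine ⟨fun x y => lt₁ x y ∨ lt₂ x y, ?_, ?_, ?_, ?_, ?_, ?_⟩
    · rintro x y (h | h)
      · exact ⟨hBU (hmem₁ _ _ h).1, hBU (hmem₁ _ _ h).2⟩
      · exact ⟨Finset.sdiff_subset (hmem₂ _ _ h).1, Finset.sdiff_subset (hmem₂ _ _ h).2⟩
    · rintro x y z (h | h) (h' | h')
      · exact Or.inl (htr₁ _ _ _ h h')
      · exact (hdis (hmem₁ _ _ h).2 (hmem₂ _ _ h').1).elim
      · exact (hdis (hmem₁ _ _ h').1 (hmem₂ _ _ h).2).elim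
      · exact Or.inr (htr₂ _ _ _ h h')
    · rintro x (h | h)
      exacts [hirr₁ x h, hirr₂ x h]
    · rintro x y z (h | h) (h' | h')
      · rcases hch₁ x y z h h' with h | h | h <;> simp [h]
      · exact (hdis (hmem₁ _ _ h).2 (hmem₂ _ _ h').2).elim
      · exact (hdis (hmem₁ _ _ h').2 (hmem₂ _ _ h).2).elim
      · rcases hch₂ x y z h h' with h | h | h <;> simp [h]
    · intro u hu v hv huv
      by_cases huB : u ∈ B
      · rcases hedge₁ u huB v (hcl u huB v hv huv) huv with h | h <;> simp [h]
      · have hvB : v ∉ B := fun h => huB (hcl v h u hu huv.symm)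
        rcases hedge₂ u (by simp [hu, huB]) v (by simp [hv, hvB]) huv with h | h <;> simp [h]
    · intro s hs hcomp
      by_cases hsB : s ⊆ B
      · refine (hsz₁ s hsB fun x hx y hy => ?_).trans (hmono hBU)
        rcases hcomp x hx y hy with h | (h | h) | (h | h)
        · exact Or.inl h
        · exact Or.inr (Or.inl h)
        · exact (hdis (hsB hx) (hmem₂ _ _ h).1).elim
        · exact Or.inr (Or.inr h)
        · exact (hdis (hsB hx) (hmem₂ _ _ h).2).elim
      · obtain ⟨z, hzs, hzB⟩ := Finset.not_subset.mp hsB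
        have hs2 : s ⊆ U \ B := by
          intro x hx
          rcases hcomp x hx z hzs with h | (h | h) | (h | h)
          · subst h; exact Finset.mem_sdiff.mpr ⟨hs hx, hzB⟩
          · exact absurd (hmem₁ _ _ h).2 hzB
          · exact (hmem₂ _ _ h).1
          · exact absurd (hmem₁ _ _ h).1 hzB
          · exact (hmem₂ _ _ h).2
        refine (hsz₂ s hs2 fun x hx y hy => ?_).trans (hmono Finset.sdiff_subset)
        rcases hcomp x hx y hy with h | (h | h) | (h | h)
        · exact Or.inl h
        · exact (hdis (hmem₁ _ _ h).1 (hs2 hx)).elim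
        · exact Or.inr (Or.inl h)
        · exact (hdis (hmem₁ _ _ h).2 (hs2 hx)).elim
        · exact Or.inr (Or.inr h)

/-- Removing a vertex with at most one neighbor keeps a set connected. -/
theorem ConnectedOn.erase {V : Type*} [DecidableEq V] {G : SimpleGraph V} {A : Finset V}
    (hA : G.ConnectedOn A) {u v : V} (hv : ∀ w ∈ A, G.Adj v w → w = u) :
    G.ConnectedOn (A.erase v) := by
  by_cases hvA : v ∈ A
  swap
  · rwa [Finset.erase_eq_of_notMem hvA]
  intro B hB hne hcl
  have hBA : B ⊆ A := hB.trans (Finset.erase_subset _ _)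
  have hvB : v ∉ B := fun h => by simpa using hB h
  by_cases huB : u ∈ B
  · have := hA (insert v B) (Finset.insert_subset hvA hBA) (Finset.insert_nonempty _ _) (by
      intro b hb a ha hab
      rw [Finset.mem_insert] at hb ⊢
      by_cases hav : a = v
      · exact Or.inl hav
      rcases hb with rfl | hb
      · rw [hv a ha hab]; exact Or.inr huB
      · exact Or.inr (hcl b hb a (Finset.mem_erase.mpr ⟨hav, ha⟩) hab))
    rw [← this, Finset.erase_insert hvB]
  · have := hA B hBA hne (by
      intro b hb a ha hab
      by_cases hav : a = v
      · subst hav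
        rw [hv b (hBA hb) hab.symm] at hb
        exact absurd hb huB
      · exact hcl b hb a (Finset.mem_erase.mpr ⟨hav, ha⟩) hab)
    exact absurd (this ▸ hvA) hvB

/-- `X` is a set of apices of `G[W]`: the function `ℓ` is the level function of a rooted forest
structure on `G[W \ X]`, and every connected subset of `W` joining two vertices of `X` meets at
least `p` residues of levels modulo `p + 1`. -/
structure IsApexLevelling {V : Type*} [DecidableEq V] (G : SimpleGraph V) (p : ℕ)
    (W X : Finset V) (ℓ : V → ℕ) : Prop where
  subset : X ⊆ W
  level_adj : ∀ u ∈ W \ X, ∀ v ∈ W \ X, G.Adj u v → ℓ u = ℓ v + 1 ∨ ℓ v = ℓ u + 1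
  parent_unique : ∀ v ∈ W \ X, ∀ u ∈ W \ X, ∀ u' ∈ W \ X, G.Adj u v → G.Adj u' v →
    ℓ v = ℓ u + 1 → ℓ v = ℓ u' + 1 → u = u'
  scattered : ∀ A ⊆ W, G.ConnectedOn A → ∀ x ∈ A, x ∈ X → ∀ y ∈ A, y ∈ X → x ≠ y →
    p ≤ ((A \ X).image fun v => ℓ v % (p + 1)).card

namespace IsApexLevelling

variable {V : Type*} [DecidableEq V] {G : SimpleGraph V} {p : ℕ} {W X : Finset V} {ℓ : V → ℕ}

/-- A vertex with at most one neighbor can be added one level below that neighbor. -/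
theorem insert_leaf (h : G.IsApexLevelling p W X ℓ) {u v : V} (hvW : v ∉ W)
    (hv : ∀ w ∈ W, G.Adj v w → w = u) :
    G.IsApexLevelling p (insert v W) X (Function.update ℓ v (ℓ u + 1)) := by
  have hvX : v ∉ X := fun hx => hvW (h.subset hx)
  have hne : ∀ {w}, w ∈ W → w ≠ v := fun hw e => hvW (e ▸ hw)
  have hmem : ∀ {w}, w ∈ insert v W \ X → w = v ∨ w ∈ W \ X := by
    intro w hw
    simp only [Finset.mem_sdiff, Finset.mem_insert] at hw ⊢
    tauto
  have hupd : ∀ {w}, w ∈ W \ X → Function.update ℓ v (ℓ u + 1) w = ℓ w := fun hw =>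
    Function.update_of_ne (hne (Finset.mem_sdiff.mp hw).1) _ _
  refine ⟨h.subset.trans (Finset.subset_insert _ _), ?_, ?_, ?_⟩
  · intro a ha b hb hab
    rcases hmem ha with rfl | ha' <;> rcases hmem hb with rfl | hb'
    · exact absurd hab (G.loopless.irrefl _)
    · rw [hupd hb', hv b (Finset.mem_sdiff.mp hb').1 hab]; simp
    · rw [hupd ha', hv a (Finset.mem_sdiff.mp ha').1 hab.symm]; simp
    · rw [hupd ha', hupd hb']; exact h.level_adj a ha' b hb' hab
  · intro b hb a ha a' ha' hab hab' hl hl'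
    rcases hmem hb with rfl | hb'
    · rcases hmem ha with rfl | ha
      · exact absurd hab (G.loopless.irrefl _)
      rcases hmem ha' with rfl | ha'
      · exact absurd hab' (G.loopless.irrefl _)
      rw [hv a (Finset.mem_sdiff.mp ha).1 hab.symm, hv a' (Finset.mem_sdiff.mp ha').1 hab'.symm]
    · rw [hupd hb'] at hl hl'
      rcases hmem ha with rfl | ha
      · rw [hv b (Finset.mem_sdiff.mp hb').1 hab] at hl
        simp at hl
        omega
      rcases hmem ha' with rfl | ha'
      · rw [hv b (Finset.mem_sdiff.mp hb').1 hab'] at hl'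
        simp at hl'
        omega
      rw [hupd ha] at hl
      rw [hupd ha'] at hl'
      exact h.parent_unique b hb' a ha a' ha' hab hab' hl hl'
  · intro A hA hconn x hxA hxX y hyA hyX hxy
    have hAW : A.erase v ⊆ W := by
      intro w hw
      rw [Finset.mem_erase] at hw
      exact (Finset.mem_insert.mp (hA hw.2)).resolve_left hw.1
    have hconn' : G.ConnectedOn (A.erase v) := hconn.erase (u := u) (by
      intro w hw hvw
      exact hv w (hAW (Finset.mem_erase.mpr ⟨hvw.ne', hw⟩)) hvw)
    refine (h.scattered _ hAW hconn' x (Finset.mem_erase.mpr ⟨hne (h.subset hxX), hxA⟩) hxX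
      y (Finset.mem_erase.mpr ⟨hne (h.subset hyX), hyA⟩) hyX hxy).trans (Finset.card_le_card ?_)
    intro r hr
    simp only [Finset.mem_image, Finset.mem_sdiff, Finset.mem_erase] at hr ⊢
    obtain ⟨w, ⟨⟨hwv, hwA⟩, hwX⟩, rfl⟩ := hr
    exact ⟨w, ⟨hwA, hwX⟩, by rw [Function.update_of_ne hwv]⟩

/-- A pendant path can be added, with levels increasing along it. -/
theorem insert_path (h : G.IsApexLevelling p W X ℓ) (e : ℕ → V) (t : ℕ)
    (hinj : Set.InjOn e (Set.Icc 0 t)) (heW : ∀ i ∈ Finset.Icc 1 t, e i ∉ W)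
    (hadj : ∀ i ∈ Finset.Icc 1 t, ∀ w ∈ W ∪ (Finset.Ico 1 i).image e, G.Adj (e i) w →
      w = e (i - 1)) :
    ∃ ℓ' : V → ℕ, G.IsApexLevelling p (W ∪ (Finset.Icc 1 t).image e) X ℓ' ∧
      (∀ w ∈ W, ℓ' w = ℓ w) ∧ ∀ i ≤ t, ℓ' (e i) = ℓ (e 0) + i := by
  induction t with
  | zero => exact ⟨ℓ, by simpa using h, by simp, by simp⟩
  | succ t ih =>
    obtain ⟨ℓ', h', hW', hℓ'⟩ := ih (hinj.mono (Set.Icc_subset_Icc_right (by omega)))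
      (fun i hi => heW i (Finset.Icc_subset_Icc_right (by omega) hi))
      (fun i hi => hadj i (Finset.Icc_subset_Icc_right (by omega) hi))
    have hnew : ∀ i ≤ t, e i ≠ e (t + 1) := by
      intro i hi hh
      have := hinj (Set.mem_Icc.mpr ⟨by omega, by omega⟩) (by simp) hh
      omega
    have hnot : e (t + 1) ∉ W ∪ (Finset.Icc 1 t).image e := by
      simp only [Finset.mem_union, Finset.mem_image, Finset.mem_Icc, not_or, not_exists, not_and]
      exact ⟨heW _ (by simp), fun i hi => hnew i hi.2⟩
    have hico : Finset.Ico 1 (t + 1) = Finset.Icc 1 t := by ext; simp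
    have hl := h'.insert_leaf (u := e t) hnot (by
      intro w hw hadj'
      exact hadj (t + 1) (by simp) w (by rwa [hico]) hadj')
    refine ⟨Function.update ℓ' (e (t + 1)) (ℓ' (e t) + 1), ?_, ?_, ?_⟩
    · convert hl using 1
      ext w
      simp only [Finset.mem_union, Finset.mem_insert, Finset.mem_image, Finset.mem_Icc]
      constructor
      · rintro (hw | ⟨i, hi, rfl⟩)
        · exact Or.inr (Or.inl hw)
        · rcases Nat.lt_or_ge i (t + 1) with hlt | hge
          · exact Or.inr (Or.inr ⟨i, ⟨hi.1, by omega⟩, rfl⟩)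
          · exact Or.inl (by rw [le_antisymm hi.2 hge])
      · rintro (rfl | hw | ⟨i, hi, rfl⟩)
        · exact Or.inr ⟨t + 1, by omega, rfl⟩
        · exact Or.inl hw
        · exact Or.inr ⟨i, by omega, rfl⟩
    · intro w hw
      have hne : w ≠ e (t + 1) := by
        rintro rfl
        exact heW (t + 1) (by simp) hw
      rw [Function.update_of_ne hne, hW' w hw]
    · intro i hi
      rcases Nat.lt_or_ge i (t + 1) with hlt | hge
      · rw [Function.update_of_ne (hnew i (by omega)), hℓ' i (by omega)]
      · rw [le_antisymm hi hge, Function.update_self, hℓ' t le_rfl, add_assoc]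

/-- Consecutive levels give distinct residues. -/
theorem card_residues {A : Finset V} (e : ℕ → V) (a : ℕ)
    (hA : ∀ i ∈ Finset.Icc 1 p, e i ∈ A \ X) (he : ∀ i ∈ Finset.Icc 1 p, ℓ (e i) = a + i) :
    p ≤ ((A \ X).image fun v => ℓ v % (p + 1)).card := by
  have hsub : (Finset.Icc 1 p).image (fun i => (a + i) % (p + 1)) ⊆
      (A \ X).image fun v => ℓ v % (p + 1) := by
    intro r hr
    obtain ⟨i, hi, rfl⟩ := Finset.mem_image.mp hr
    exact Finset.mem_image.mpr ⟨e i, hA i hi, by simp only [he i hi]⟩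
  refine le_trans ?_ (Finset.card_le_card hsub)
  rw [Finset.card_image_of_injOn]
  · simp
  · intro i hi j hj hij
    simp only [Finset.coe_Icc, Set.mem_Icc] at hi hj
    have h1 : i ≡ j [MOD p + 1] := Nat.ModEq.add_left_cancel' a hij
    exact Nat.ModEq.eq_of_lt_of_lt h1 (by omega) (by omega)

/-- An ear with `2 * p + 1` inner vertices can be added, its middle vertex being a new apex. -/
theorem insert_ear (e : ℕ → V) (hinj : Set.InjOn e (Set.Icc 0 (2 * p + 2)))
    (heW : ∀ i ≤ 2 * p + 2, e i ∈ W)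
    (hadj : ∀ i ∈ Finset.Icc 1 (2 * p + 1), ∀ w ∈ W, G.Adj (e i) w →
      w = e (i - 1) ∨ w = e (i + 1))
    (h : G.IsApexLevelling p (W \ (Finset.Icc 1 (2 * p + 1)).image e) X ℓ) :
    ∃ X' ℓ', G.IsApexLevelling p W X' ℓ' := by
  have hinj' : ∀ i ≤ 2 * p + 2, ∀ j ≤ 2 * p + 2, e i = e j → i = j := fun i hi j hj hij =>
    hinj (by simpa using hi) (by simpa using hj) hij
  set I := (Finset.Icc 1 (2 * p + 1)).image e with hI
  have hmemI : ∀ i ∈ Finset.Icc 1 (2 * p + 1), e i ∈ I := fun i hi =>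
    Finset.mem_image_of_mem _ hi
  have hnotW : ∀ i ∈ Finset.Icc 1 (2 * p + 1), e i ∉ W \ I := fun i hi hh =>
    (Finset.mem_sdiff.mp hh).2 (hmemI i hi)
  simp only [Finset.mem_Icc] at hadj hmemI hnotW
  obtain ⟨ℓ₁, h₁, hW₁, hℓ₁⟩ := h.insert_path e p (hinj.mono (Set.Icc_subset_Icc_right (by omega)))
    (fun i hi => hnotW i (by simp at hi; omega)) (by
      intro i hi w hw hiw
      simp only [Finset.mem_Icc] at hi
      simp only [Finset.mem_union, Finset.mem_image, Finset.mem_Ico] at hw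
      have hwW : w ∈ W := by
        rcases hw with hw | ⟨j, hj, rfl⟩
        · exact (Finset.mem_sdiff.mp hw).1
        · exact heW j (by omega)
      rcases hadj i (by omega) w hwW hiw with hw' | rfl
      · exact hw'
      · rcases hw with hw | ⟨j, hj, hje⟩
        · exact absurd hw (hnotW (i + 1) (by omega))
        · have := hinj' j (by omega) (i + 1) (by omega) hje
          omega)
  set W₁ := W \ I ∪ (Finset.Icc 1 p).image e with hW₁def
  have hW₁mem : ∀ i, p < i → i ≤ 2 * p + 1 → e i ∉ W₁ := by
    intro i hi hi' hh
    simp only [hW₁def, Finset.mem_union, Finset.mem_image, Finset.mem_Icc] at hh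
    rcases hh with hh | ⟨j, hj, hje⟩
    · exact hnotW i (by omega) hh
    · have := hinj' j (by omega) i (by omega) hje
      omega
  have hW₁W : W₁ ⊆ W := by
    intro w hw
    simp only [hW₁def, Finset.mem_union, Finset.mem_image, Finset.mem_Icc] at hw
    rcases hw with hw | ⟨j, hj, rfl⟩
    · exact (Finset.mem_sdiff.mp hw).1
    · exact heW j (by omega)
  obtain ⟨ℓ₂, h₂, hW₂, hℓ₂⟩ := h₁.insert_path (fun i => e (2 * p + 2 - i)) p (by
      intro i hi j hj hij
      simp only [Set.mem_Icc] at hi hj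
      have := hinj' _ (by omega) _ (by omega) hij
      omega)
    (fun i hi => hW₁mem _ (by simp at hi; omega) (by simp at hi; omega)) (by
      intro i hi w hw hiw
      simp only [Finset.mem_Icc] at hi
      simp only [Finset.mem_union (s := W₁), Finset.mem_image, Finset.mem_Ico] at hw
      have hwW : w ∈ W := by
        rcases hw with hw | ⟨j, hj, rfl⟩
        · exact hW₁W hw
        · exact heW _ (by omega)
      rcases hadj (2 * p + 2 - i) (by omega) w hwW hiw with rfl | rfl
      · rcases hw with hw | ⟨j, hj, hje⟩
        · exact absurd hw (hW₁mem _ (by omega) (by omega))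
        · have := hinj' _ (by omega) _ (by omega) hje
          omega
      · congr 1
        omega)
  set W₂ := W₁ ∪ (Finset.Icc 1 p).image (fun i => e (2 * p + 2 - i)) with hW₂def
  have hmid : e (p + 1) ∉ W₂ := by
    simp only [hW₂def, Finset.mem_union (s := W₁), Finset.mem_image, Finset.mem_Icc, not_or,
      not_exists, not_and]
    refine ⟨hW₁mem _ (by omega) (by omega), fun j hj hje => ?_⟩
    have := hinj' _ (by omega) _ (by omega) hje
    omega
  have hW₂W : insert (e (p + 1)) W₂ = W := by
    ext w
    simp only [hW₂def, hW₁def, Finset.mem_insert, Finset.mem_union, Finset.mem_image,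
      Finset.mem_Icc]
    constructor
    · rintro (rfl | (hw | ⟨j, hj, rfl⟩) | ⟨j, hj, rfl⟩)
      · exact heW _ (by omega)
      · exact (Finset.mem_sdiff.mp hw).1
      · exact heW _ (by omega)
      · exact heW _ (by omega)
    · intro hw
      by_cases hwI : w ∈ I
      · obtain ⟨i, hi, rfl⟩ := Finset.mem_image.mp hwI
        simp only [Finset.mem_Icc] at hi
        rcases lt_trichotomy i (p + 1) with hlt | rfl | hgt
        · exact Or.inr (Or.inl (Or.inr ⟨i, by omega, rfl⟩))
        · exact Or.inl rfl
        · exact Or.inr (Or.inr ⟨2 * p + 2 - i, by omega, by congr 1; omega⟩)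
      · exact Or.inr (Or.inl (Or.inl (Finset.mem_sdiff.mpr ⟨hw, hwI⟩)))
  have heX : ∀ i, 1 ≤ i → i ≤ 2 * p + 1 → e i ∉ X := fun i hi hi' hx =>
    hnotW i ⟨hi, hi'⟩ (h.subset hx)
  have hsd : W \ insert (e (p + 1)) X = W₂ \ X := by
    rw [← hW₂W]
    ext w
    simp only [Finset.mem_sdiff, Finset.mem_insert]
    constructor
    · tauto
    · rintro ⟨hw, hwX⟩
      have : w ≠ e (p + 1) := fun hh => hmid (hh ▸ hw)
      tauto
  refine ⟨insert (e (p + 1)) X, ℓ₂, ?_, ?_, ?_, ?_⟩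
  · rw [← hW₂W]
    exact Finset.insert_subset_insert _ h₂.subset
  · rw [hsd]; exact h₂.level_adj
  · rw [hsd]; exact h₂.parent_unique
  · intro A hA hconn x hxA hxX y hyA hyX hxy
    by_cases hm : e (p + 1) ∈ A
    swap
    · have hAW : A ⊆ W₂ := by
        intro w hw
        have := hA hw
        rw [← hW₂W, Finset.mem_insert] at this
        exact this.resolve_left fun hh => hm (hh ▸ hw)
      have := h₂.scattered A hAW hconn x hxA
        ((Finset.mem_insert.mp hxX).resolve_left fun hh => hm (hh ▸ hxA)) y hyA
        ((Finset.mem_insert.mp hyX).resolve_left fun hh => hm (hh ▸ hyA)) hxy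
      rwa [Finset.sdiff_insert_of_notMem hm]
    obtain ⟨z, hzA, hzX⟩ : ∃ z ∈ A, z ∈ X := by
      rcases Finset.mem_insert.mp hxX with rfl | hx
      · exact ⟨y, hyA, (Finset.mem_insert.mp hyX).resolve_left hxy.symm⟩
      · exact ⟨x, hxA, hx⟩
    by_cases hleft : ∀ i ∈ Finset.Icc 1 p, e i ∈ A
    · refine card_residues e (ℓ (e 0)) (fun i hi => ?_) (fun i hi => ?_)
      · have hi' := Finset.mem_Icc.mp hi
        simp only [Finset.mem_sdiff, Finset.mem_insert, not_or]
        refine ⟨hleft i hi, fun hh => ?_, heX i (by omega) (by omega)⟩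
        have := hinj' _ (by omega) _ (by omega) hh
        omega
      · have hi' := Finset.mem_Icc.mp hi
        rw [hW₂ (e i) (Finset.mem_union_right _ (Finset.mem_image_of_mem _ hi)), hℓ₁ i hi'.2]
    by_cases hright : ∀ i ∈ Finset.Icc 1 p, e (2 * p + 2 - i) ∈ A
    · refine card_residues (fun i => e (2 * p + 2 - i)) (ℓ₁ (e (2 * p + 2 - 0)))
        (fun i hi => ?_) (fun i hi => hℓ₂ i (Finset.mem_Icc.mp hi).2)
      have hi' := Finset.mem_Icc.mp hi
      simp only [Finset.mem_sdiff, Finset.mem_insert, not_or]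
      refine ⟨hright i hi, fun hh => ?_, heX _ (by omega) (by omega)⟩
      have := hinj' _ (by omega) _ (by omega) hh
      omega
    push Not at hleft hright
    obtain ⟨i, hi, hiA⟩ := hleft
    obtain ⟨j, hj, hjA⟩ := hright
    simp only [Finset.mem_Icc] at hi hj
    classical
    have hB := hconn (A.filter fun w => ∃ k, i < k ∧ k < 2 * p + 2 - j ∧ w = e k)
      (Finset.filter_subset _ _) ⟨e (p + 1), by
        simp only [Finset.mem_filter]
        exact ⟨hm, p + 1, by omega, by omega, rfl⟩⟩ (by
        intro b hb a ha hab
        simp only [Finset.mem_filter] at hb ⊢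
        obtain ⟨hbA, k, hik, hkj, rfl⟩ := hb
        refine ⟨ha, ?_⟩
        rcases hadj k (by omega) a (hA ha) hab with rfl | rfl
        · refine ⟨k - 1, ?_, by omega, rfl⟩
          by_contra hcon
          have : k - 1 = i := by omega
          exact hiA (this ▸ ha)
        · refine ⟨k + 1, by omega, ?_, rfl⟩
          by_contra hcon
          have : k + 1 = 2 * p + 2 - j := by omega
          exact hjA (this ▸ ha))
    rw [← hB, Finset.mem_filter] at hzA
    obtain ⟨_, k, hik, hkj, rfl⟩ := hzA
    exact absurd hzX (heX k (by omega) (by omega))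

/-- In an apex levelling, connected sets with few colors have a uniquely colored vertex. -/
theorem exists_unique_color (h : G.IsApexLevelling p W X ℓ) (c : V → ℕ)
    (hcX : ∀ v ∈ X, c v = p + 1) (hc : ∀ v ∉ X, c v = ℓ v % (p + 1)) {A : Finset V} (hAW : A ⊆ W)
    (hne : A.Nonempty) (hA : G.ConnectedOn A) (hcard : (A.image c).card ≤ p) :
    ∃ a ∈ A, ∀ b ∈ A, c b = c a → b = a := by
  have hlt : ∀ v ∉ X, c v < p + 1 := fun v hv => by
    rw [hc v hv]; exact Nat.mod_lt _ (by omega)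
  by_cases hAX : ∃ x ∈ A, x ∈ X
  · obtain ⟨x, hxA, hxX⟩ := hAX
    refine ⟨x, hxA, fun y hyA hyx => ?_⟩
    by_contra hyne
    have hyX : y ∈ X := by
      by_contra hy
      have := hlt y hy
      rw [hyx, hcX x hxX] at this
      omega
    have h1 := h.scattered A hAW hA x hxA hxX y hyA hyX (Ne.symm hyne)
    have h2 : insert (p + 1) ((A \ X).image fun v => ℓ v % (p + 1)) ⊆ A.image c := by
      intro r hr
      rcases Finset.mem_insert.mp hr with rfl | hr
      · exact Finset.mem_image.mpr ⟨x, hxA, hcX x hxX⟩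
      · obtain ⟨v, hv, rfl⟩ := Finset.mem_image.mp hr
        rw [Finset.mem_sdiff] at hv
        exact Finset.mem_image.mpr ⟨v, hv.1, hc v hv.2⟩
    have h3 := Finset.card_le_card h2
    rw [Finset.card_insert_of_notMem] at h3
    · omega
    · intro hh
      obtain ⟨v, -, hv⟩ := Finset.mem_image.mp hh
      have := Nat.mod_lt (ℓ v) (show 0 < p + 1 by omega)
      omega
  · push Not at hAX
    obtain ⟨a, haA, hmin⟩ := A.exists_min_image ℓ hne
    have hsd : ∀ {w}, w ∈ A → w ∈ W \ X := fun hw =>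
      Finset.mem_sdiff.mpr ⟨hAW hw, hAX _ hw⟩
    let S : V → V → Prop := fun v w => w ∈ A ∧ v ∈ A ∧ G.Adj v w ∧ ℓ w = ℓ v + 1
    classical
    have hreach := hA (A.filter fun v => Relation.ReflTransGen S a v) (Finset.filter_subset _ _)
      ⟨a, Finset.mem_filter.mpr ⟨haA, .refl⟩⟩ (by
        intro v hv w hw hvw
        rw [Finset.mem_filter] at hv ⊢
        refine ⟨hw, ?_⟩
        rcases h.level_adj v (hsd hv.1) w (hsd hw) hvw with hl | hl
        · rcases hv.2.cases_tail with rfl | ⟨u, hau, huv⟩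
          · have := hmin w hw
            omega
          · rwa [h.parent_unique v (hsd hv.1) w (hsd hw) u (hsd huv.2.1) hvw.symm huv.2.2.1 hl
              huv.2.2.2]
        · exact hv.2.tail ⟨hw, hv.1, hvw, hl⟩)
    have hlevels : ∀ v, Relation.ReflTransGen S a v → ∀ k, ℓ a ≤ k → k ≤ ℓ v →
        ∃ w ∈ A, ℓ w = k := by
      intro v hv
      induction hv with
      | refl => exact fun k h1 h2 => ⟨a, haA, le_antisymm h1 h2⟩
      | @tail u w _ hs ih =>
        intro k h1 h2
        rcases Nat.lt_or_ge (ℓ u) k with hlt' | hge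
        · exact ⟨_, hs.1, by have := hs.2.2.2; omega⟩
        · exact ih k h1 hge
    refine ⟨a, haA, fun b hb hba => ?_⟩
    have hbr : Relation.ReflTransGen S a b := by
      rw [← hreach] at hb
      exact (Finset.mem_filter.mp hb).2
    rw [hc b (hAX b hb), hc a (hAX a haA)] at hba
    have hab := hmin b hb
    rcases Nat.lt_or_ge (ℓ b) (ℓ a + (p + 1)) with hlt' | hge
    · have heq : ℓ b = ℓ a := by
        have h1 : ℓ b - ℓ a ≡ 0 [MOD p + 1] := by
          have : ℓ a + (ℓ b - ℓ a) ≡ ℓ a + 0 [MOD p + 1] := by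
            rw [Nat.add_sub_cancel' hab]; exact hba
          exact Nat.ModEq.add_left_cancel' _ this
        have h2 := Nat.ModEq.eq_of_lt_of_lt h1 (by omega) (by omega)
        omega
      rcases hbr.cases_tail with rfl | ⟨u, hau, hub⟩
      · rfl
      · have h1 := hub.2.2.2
        have h2 := hmin u hub.2.1
        omega
    · have hsub : (Finset.range (p + 1)).image (fun i => (ℓ a + i) % (p + 1)) ⊆ A.image c := by
        intro r hr
        obtain ⟨i, hi, rfl⟩ := Finset.mem_image.mp hr
        rw [Finset.mem_range] at hi
        obtain ⟨w, hw, hwl⟩ := hlevels b hbr (ℓ a + i) (by omega) (by omega)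
        exact Finset.mem_image.mpr ⟨w, hw, by rw [hc w (hAX w hw), hwl]⟩
      have h3 := Finset.card_le_card hsub
      rw [Finset.card_image_of_injOn] at h3
      · simp at h3
        omega
      · intro i hi j hj hij
        simp only [Finset.coe_range, Set.mem_Iio] at hi hj
        exact Nat.ModEq.eq_of_lt_of_lt (Nat.ModEq.add_left_cancel' (ℓ a) hij) hi hj

end IsApexLevelling
/-- A short walk between the ends of an edge uses that edge. -/
theorem edge_mem_edges_of_lt_egirth {V : Type*} [DecidableEq V] {G : SimpleGraph V} {a b : V}
    (hab : G.Adj a b) (q : G.Walk b a) (hlen : ((q.length + 1 : ℕ) : ℕ∞) < G.egirth) :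
    s(a, b) ∈ q.edges := by
  by_contra hq
  have hc : (Walk.cons hab q.bypass).IsCycle :=
    Path.cons_isCycle ⟨q.bypass, q.bypass_isPath⟩ hab fun h => hq (q.edges_bypass_subset_edges h)
  have h1 := egirth_le_length hc
  have h2 := q.length_bypass_le_length
  refine absurd (h1.trans ?_) (not_le.mpr hlen)
  rw [Walk.length_cons]
  exact_mod_cast Nat.succ_le_succ h2

/-- The initial segments of a sequence of successively adjacent vertices are walks. -/
theorem exists_walk_of_seq {V : Type*} {G : SimpleGraph V} (e : ℕ → V)
    (he : ∀ i, G.Adj (e i) (e (i + 1))) (i n : ℕ) :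
    ∃ q : G.Walk (e i) (e (i + n)), q.length = n ∧
      ∀ f ∈ q.edges, ∃ k, i ≤ k ∧ k < i + n ∧ f = s(e k, e (k + 1)) := by
  induction n with
  | zero => exact ⟨.nil, rfl, by simp⟩
  | succ n ih =>
    obtain ⟨q, hq, hqe⟩ := ih
    refine ⟨q.concat (he (i + n)), by simp [hq], fun f hf => ?_⟩
    rw [Walk.edges_concat, List.concat_eq_append, List.mem_append, List.mem_singleton] at hf
    rcases hf with hf | rfl
    · obtain ⟨k, h1, h2, h3⟩ := hqe f hf
      exact ⟨k, h1, by omega, h3⟩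
    · exact ⟨i + n, by omega, by omega, rfl⟩

/-- Non-backtracking sequences shorter than the girth are injective. -/
theorem injOn_of_lt_egirth {V : Type*} [DecidableEq V] {G : SimpleGraph V} (e : ℕ → V)
    (he : ∀ i, G.Adj (e i) (e (i + 1))) (hnb : ∀ i, e (i + 2) ≠ e i) {N : ℕ}
    (hN : (N : ℕ∞) < G.egirth) : Set.InjOn e (Set.Icc 0 N) := by
  have key : ∀ n, 1 ≤ n → n ≤ N → ∀ i, e i ≠ e (i + n) := by
    intro n
    induction n using Nat.strong_induction_on with
    | _ n ih =>
    intro h1 hnN i hi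
    obtain ⟨q, hq, hqe⟩ := exists_walk_of_seq e he (i + 1) (n - 1)
    have hend : e (i + 1 + (n - 1)) = e i := by rw [hi]; congr 1; omega
    have hmem := edge_mem_edges_of_lt_egirth (he i) (q.copy rfl hend) (by
      rw [Walk.length_copy, hq, Nat.sub_add_cancel h1]
      exact lt_of_le_of_lt (by exact_mod_cast hnN) hN)
    rw [Walk.edges_copy] at hmem
    obtain ⟨k, hk1, hk2, hk⟩ := hqe _ hmem
    rw [Sym2.eq_iff] at hk
    rcases hk with ⟨hk, -⟩ | ⟨hk, hk'⟩
    · refine ih (k - i) (by omega) (by omega) (by omega) i ?_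
      rw [hk]; congr 1; omega
    · rcases Nat.lt_or_ge (k + 1) (i + n) with hlt | hge
      · refine ih (k + 1 - i) (by omega) (by omega) (by omega) i ?_
        rw [hk]; congr 1; omega
      · rcases Nat.lt_or_ge (i + 1) k with hlt' | hge'
        · refine ih (k - (i + 1)) (by omega) (by omega) (by omega) (i + 1) ?_
          rw [hk']; congr 1; omega
        · obtain rfl : k = i + 1 := by omega
          exact hnb i hk.symm
  intro i hi j hj hij
  rw [Set.mem_Icc] at hi hj
  rcases lt_trichotomy i j with hlt | rfl | hgt
  · exact absurd (by rw [hij]; congr 1; omega) (key (j - i) (by omega) (by omega) i)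
  · rfl
  · exact absurd (by rw [← hij]; congr 1; omega) (key (i - j) (by omega) (by omega) j)

/-- If all degrees in `G[W]` are at least two, then non-backtracking sequences start anywhere. -/
theorem exists_nonbacktracking_seq {V : Type*} {G : SimpleGraph V} {W : Finset V}
    (hdeg : ∀ v ∈ W, ∀ u, ∃ w ∈ W, G.Adj v w ∧ w ≠ u) {v : V} (hv : v ∈ W) :
    ∃ e : ℕ → V, e 1 = v ∧ (∀ i, e i ∈ W) ∧ (∀ i, G.Adj (e i) (e (i + 1))) ∧
      ∀ i, e (i + 2) ≠ e i := by
  obtain ⟨u, huW, hvu, -⟩ := hdeg v hv v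
  choose f hfW hfadj hfne using fun (v : W) u => hdeg v v.2 u
  let next : W × W → W × W := fun x => (x.2, ⟨f x.2 x.1, hfW x.2 x.1⟩)
  let s : ℕ → W × W := fun n => next^[n] (⟨u, huW⟩, ⟨v, hv⟩)
  have hs : ∀ n, s (n + 1) = next (s n) := fun n => Function.iterate_succ_apply' _ _ _
  have h1 : ∀ n, (s (n + 1)).1 = (s n).2 := fun n => by rw [hs]
  have hadj : ∀ n, G.Adj (s n).1 (s n).2 := by
    intro n
    induction n with
    | zero => exact hvu.symm
    | succ n ih => rw [hs]; exact hfadj _ _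
  refine ⟨fun n => (s n).1, rfl, fun n => (s n).1.2, fun n => ?_, fun n => ?_⟩
  · simp only [h1]; exact hadj n
  · simp only [hs]; exact hfne _ _

/-- If every vertex of `W` is joined in `G[W]` to `T` by a walk of length at most `L`, then `W` is
covered by disjoint trees of depth at most `L` rooted at `T`. -/
theorem exists_parent {V : Type*} {G : SimpleGraph V} {W T : Finset V} {L : ℕ}
    (h : ∀ v ∈ W, ∃ e : ℕ → V, ∃ s ≤ L, e 0 = v ∧ (∀ i, e i ∈ W) ∧
      (∀ i, G.Adj (e i) (e (i + 1))) ∧ e s ∈ T) :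
    ∃ (par : V → V) (D : V → ℕ), (∀ v ∈ W, D v ≤ L) ∧ (∀ v ∈ T, par v = v) ∧
      ∀ v ∈ W, v ∉ T → par v ∈ W ∧ G.Adj v (par v) ∧ D (par v) < D v := by
  let S : V → Set ℕ := fun v => {s | ∃ e : ℕ → V, e 0 = v ∧ (∀ i, e i ∈ W) ∧
    (∀ i, G.Adj (e i) (e (i + 1))) ∧ e s ∈ T}
  have hpar : ∀ v, ∃ u, (v ∈ T → u = v) ∧
      (v ∈ W → v ∉ T → u ∈ W ∧ G.Adj v u ∧ sInf (S u) < sInf (S v)) := by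
    intro v
    by_cases hvT : v ∈ T
    · exact ⟨v, fun _ => rfl, fun _ h' => absurd hvT h'⟩
    by_cases hvW : v ∈ W
    swap
    · exact ⟨v, fun _ => rfl, fun h' => absurd h' hvW⟩
    obtain ⟨e, s, -, he⟩ := h v hvW
    obtain ⟨e, he0, heW, hadj, heT⟩ := Nat.sInf_mem (s := S v) ⟨s, e, he⟩
    have hpos : sInf (S v) ≠ 0 := fun h0 => hvT (by rw [h0, he0] at heT; exact heT)
    refine ⟨e 1, fun h' => absurd h' hvT, fun _ _ => ⟨heW 1, he0 ▸ hadj 0, ?_⟩⟩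
    have : sInf (S (e 1)) ≤ sInf (S v) - 1 := by
      refine Nat.sInf_le ⟨fun i => e (i + 1), rfl, fun i => heW _, fun i => hadj _, ?_⟩
      simpa only [Nat.sub_add_cancel (Nat.pos_of_ne_zero hpos)] using heT
    omega
  choose par hT hW using hpar
  refine ⟨par, fun v => sInf (S v), fun v hv => ?_, hT, hW⟩
  obtain ⟨e, s, hs, he⟩ := h v hv
  exact (Nat.sInf_le ⟨e, he⟩ : sInf (S v) ≤ s).trans hs

/-- Following parents leads to the root within the tree. -/
theorem exists_walk_to_root {V : Type*} {G : SimpleGraph V} {W T : Finset V} {par root : V → V}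
    {D : V → ℕ} (hW : ∀ v ∈ W, v ∉ T → par v ∈ W ∧ G.Adj v (par v) ∧ D (par v) < D v)
    (hroot : ∀ v ∈ W, v ∉ T → root (par v) = root v) (hrootT : ∀ v ∈ T, root v = v) (n : ℕ) :
    ∀ v ∈ W, D v ≤ n → ∀ t, root v = t → ∃ q : G.Walk v t, q.length ≤ n ∧
      (∀ f ∈ q.edges, ∃ x ∈ W, x ∉ T ∧ f = s(x, par x)) ∧
      ∀ x ∈ q.support, x ∈ W ∧ root x = t := by
  induction n with
  | zero =>
    intro v hv hD t ht
    have hvT : v ∈ T := by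
      by_contra hvT
      have := (hW v hv hvT).2.2
      omega
    obtain rfl : v = t := by rw [← ht, hrootT v hvT]
    exact ⟨.nil, le_rfl, by simp, by simp [hv, ht]⟩
  | succ n ih =>
    intro v hv hD t ht
    by_cases hvT : v ∈ T
    · obtain rfl : v = t := by rw [← ht, hrootT v hvT]
      exact ⟨.nil, by simp, by simp, by simp [hv, ht]⟩
    · obtain ⟨h1, h2, h3⟩ := hW v hv hvT
      obtain ⟨q, hq, hqe, hqs⟩ := ih (par v) h1 (by omega) t (by rw [hroot v hv hvT, ht])
      refine ⟨.cons h2 q, by simpa using hq, fun f hf => ?_, fun x hx => ?_⟩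
      · rw [Walk.edges_cons, List.mem_cons] at hf
        rcases hf with rfl | hf
        · exact ⟨v, hv, hvT, rfl⟩
        · exact hqe f hf
      · rw [Walk.support_cons, List.mem_cons] at hx
        rcases hx with rfl | hx
        · exact ⟨hv, ht⟩
        · exact hqs x hx

/-- Twice the number of edges is the number of ordered pairs of adjacent vertices. -/
theorem two_mul_card_edgeSet {ι : Type*} [Fintype ι] (H : SimpleGraph ι) [DecidableRel H.Adj] :
    2 * Nat.card H.edgeSet =
      ((Finset.univ ×ˢ Finset.univ).filter fun x : ι × ι => H.Adj x.1 x.2).card := by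
  classical
  rw [Nat.card_eq_fintype_card, ← edgeFinset_card, ← sum_degrees_eq_twice_card_edges,
    Finset.card_filter, Finset.sum_product]
  refine Finset.sum_congr rfl fun v _ => ?_
  rw [← Finset.card_filter, ← card_neighborFinset_eq_degree, neighborFinset_eq_filter]

/-- If `G` has large girth, `G[W]` has minimum degree at least two and every long non-backtracking
sequence in it meets a vertex of degree at least three, then contracting onto the vertices of
degree at least three gives a shallow minor of average degree at least three. -/
theorem exists_dense_shallowMinor {V : Type*} [DecidableEq V] {G : SimpleGraph V} {W : Finset V}
    (L : ℕ) (hne : W.Nonempty) (hgirth : ((4 * L + 2 : ℕ) : ℕ∞) < G.egirth)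
    (hdeg : ∀ v ∈ W, ∀ u, ∃ w ∈ W, G.Adj v w ∧ w ≠ u)
    (hear : ∀ e : ℕ → V, (∀ i, e i ∈ W) → (∀ i, G.Adj (e i) (e (i + 1))) →
      (∀ i, e (i + 2) ≠ e i) →
      ∃ i ≤ L, ∃ w ∈ W, G.Adj (e (i + 1)) w ∧ w ≠ e i ∧ w ≠ e (i + 2)) :
    ∃ (h : ℕ) (H : SimpleGraph (Fin h)), 0 < h ∧ G.IsShallowMinor L H ∧
      3 * h ≤ 2 * Nat.card H.edgeSet := by
  classical
  set N : V → Finset V := fun v => W.filter (G.Adj v) with hN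
  set T := W.filter fun v => 3 ≤ (N v).card with hT
  have hTW : T ⊆ W := Finset.filter_subset _ _
  have hNT : ∀ v ∈ W, 2 + (if v ∈ T then 1 else 0) ≤ (N v).card := by
    intro v hv
    by_cases hvT : v ∈ T
    · simpa [hvT] using (Finset.mem_filter.mp hvT).2
    · obtain ⟨u, hu, hvu, -⟩ := hdeg v hv v
      obtain ⟨w, hw, hvw, hwu⟩ := hdeg v hv u
      have : ({u, w} : Finset V) ⊆ N v := by
        intro x hx
        simp only [Finset.mem_insert, Finset.mem_singleton] at hx
        rcases hx with rfl | rfl <;> simp [*]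
      have h2 := Finset.card_le_card this
      rw [Finset.card_pair hwu.symm] at h2
      simpa [hvT] using h2
  obtain ⟨par, D, hDL, hparT, hparW⟩ := exists_parent (G := G) (W := W) (T := T) (L := L) (by
    intro v hv
    obtain ⟨e, he1, heW, hadj, hnb⟩ := exists_nonbacktracking_seq hdeg hv
    obtain ⟨i, hi, w, hw, hiw, hw1, hw2⟩ := hear e heW hadj hnb
    refine ⟨fun i => e (i + 1), i, hi, he1, fun i => heW _, fun i => hadj _, ?_⟩
    refine Finset.mem_filter.mpr ⟨heW _, ?_⟩
    have : ({w, e i, e (i + 2)} : Finset V) ⊆ N (e (i + 1)) := by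
      intro x hx
      simp only [Finset.mem_insert, Finset.mem_singleton] at hx
      rcases hx with rfl | rfl | rfl
      · exact Finset.mem_filter.mpr ⟨hw, hiw⟩
      · exact Finset.mem_filter.mpr ⟨heW _, (hadj i).symm⟩
      · exact Finset.mem_filter.mpr ⟨heW _, hadj (i + 1)⟩
    refine le_trans (le_of_eq ?_) (Finset.card_le_card this)
    rw [Finset.card_insert_of_notMem (by simp [hw1, hw2]), Finset.card_pair (hnb i).symm])
  set root : V → V := par^[L] with hroot
  have hiter : ∀ n, ∀ v ∈ W, D v ≤ n → par^[n] v ∈ T := by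
    intro n
    induction n with
    | zero =>
      intro v hv hD
      by_contra hvT
      have := (hparW v hv hvT).2.2
      omega
    | succ n ih =>
      intro v hv hD
      by_cases hvT : v ∈ T
      · rwa [Function.iterate_fixed (hparT v hvT)]
      · obtain ⟨h1, -, h3⟩ := hparW v hv hvT
        rw [Function.iterate_succ_apply]
        exact ih _ h1 (by omega)
  have hrootmem : ∀ v ∈ W, root v ∈ T := fun v hv => hiter L v hv (hDL v hv)
  have hrootT : ∀ v ∈ T, root v = v := fun v hv => Function.iterate_fixed (hparT v hv) _
  have hrootpar : ∀ v ∈ W, root (par v) = root v := fun v hv => by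
    rw [hroot, ← Function.iterate_succ_apply, Function.iterate_succ_apply',
      hparT _ (hrootmem v hv)]
  have hwalk : ∀ v ∈ W, ∀ t, root v = t → ∃ q : G.Walk v t, q.length ≤ L ∧
      (∀ f ∈ q.edges, ∃ x ∈ W, x ∉ T ∧ f = s(x, par x)) ∧
      ∀ x ∈ q.support, x ∈ W ∧ root x = t := fun v hv =>
    exists_walk_to_root hparW (fun v hv _ => hrootpar v hv) hrootT L v hv (hDL v hv)
  have hinternal : ∀ a ∈ W, ∀ b ∈ W, G.Adj a b → root a = root b →
      ∃ x ∈ W, x ∉ T ∧ s(a, b) = s(x, par x) := by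
    intro a ha b hb hab hr
    obtain ⟨qa, hqa, hqae, -⟩ := hwalk a ha (root b) hr
    obtain ⟨qb, hqb, hqbe, -⟩ := hwalk b hb (root b) rfl
    have := edge_mem_edges_of_lt_egirth hab (qb.append qa.reverse) (by
      refine lt_of_le_of_lt ?_ hgirth
      rw [Walk.length_append, Walk.length_reverse]
      exact_mod_cast (by omega))
    rw [Walk.edges_append, Walk.edges_reverse, List.mem_append, List.mem_reverse] at this
    exact this.elim (hqbe _) (hqae _)
  have hcross : ∀ a ∈ W, ∀ b ∈ W, G.Adj a b → root a ≠ root b → ∀ a' ∈ W, ∀ b' ∈ W,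
      G.Adj a' b' → root a' = root a → root b' = root b → a = a' ∧ b = b' := by
    intro a ha b hb hab hr a' ha' b' hb' hab' hra hrb
    obtain ⟨qa, hqa, hqae, -⟩ := hwalk a ha (root a) rfl
    obtain ⟨qb, hqb, hqbe, -⟩ := hwalk b hb (root b) rfl
    obtain ⟨qa', hqa', hqae', -⟩ := hwalk a' ha' (root a) hra
    obtain ⟨qb', hqb', hqbe', -⟩ := hwalk b' hb' (root b) hrb
    have := edge_mem_edges_of_lt_egirth hab
      ((qb.append qb'.reverse).append (.cons hab'.symm (qa'.append qa.reverse))) (by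
      refine lt_of_le_of_lt ?_ hgirth
      simp only [Walk.length_append, Walk.length_reverse, Walk.length_cons]
      exact_mod_cast (by omega))
    simp only [Walk.edges_append, Walk.edges_reverse, Walk.edges_cons, List.mem_append,
      List.mem_reverse, List.mem_cons] at this
    have hno : ¬ ∃ x ∈ W, x ∉ T ∧ s(a, b) = s(x, par x) := by
      rintro ⟨x, hx, -, hxe⟩
      rcases Sym2.eq_iff.mp hxe with ⟨rfl, rfl⟩ | ⟨rfl, rfl⟩
      · exact hr (hrootpar _ hx).symm
      · exact hr (hrootpar _ hx)
    rcases this with (h | h) | h | h | h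
    · exact absurd (hqbe _ h) hno
    · exact absurd (hqbe' _ h) hno
    · rcases Sym2.eq_iff.mp h with ⟨rfl, rfl⟩ | ⟨rfl, rfl⟩
      · exact absurd hrb hr
      · exact ⟨rfl, rfl⟩
    · exact absurd (hqae' _ h) hno
    · exact absurd (hqae _ h) hno
  obtain ⟨v₀, hv₀⟩ := hne
  have hTpos : 0 < T.card := Finset.card_pos.mpr ⟨_, hrootmem v₀ hv₀⟩
  have hψ : ∀ v, ∃ i : Fin T.card, v ∈ W → ((T.equivFin.symm i : T) : V) = root v := by
    intro v
    by_cases hv : v ∈ W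
    · exact ⟨T.equivFin ⟨root v, hrootmem v hv⟩, fun _ => by simp⟩
    · exact ⟨⟨0, hTpos⟩, fun h => absurd h hv⟩
  choose ψ hψ using hψ
  have hψroot : ∀ a ∈ W, ∀ b ∈ W, ψ a = ψ b → root a = root b := fun a ha b hb h => by
    rw [← hψ a ha, ← hψ b hb, h]
  let A : Fin T.card → Set V := fun i => {v | v ∈ W ∧ root v = T.equivFin.symm i}
  let H : SimpleGraph (Fin T.card) :=
    SimpleGraph.fromRel fun i j => ∃ a ∈ A i, ∃ b ∈ A j, G.Adj a b
  refine ⟨T.card, H, hTpos, ⟨A, ?_, ?_, ?_⟩, ?_⟩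
  · intro i j hij
    refine Set.disjoint_left.mpr fun v hi hj => hij ?_
    exact T.equivFin.symm.injective (Subtype.ext (hi.2.symm.trans hj.2))
  · intro i
    have hiT := (T.equivFin.symm i).2
    refine ⟨⟨T.equivFin.symm i, hTW hiT, hrootT _ hiT⟩, fun v => ?_⟩
    obtain ⟨q, hq, -, hqs⟩ := hwalk v v.2.1 _ v.2.2
    refine ⟨q.reverse.induce (A i) fun x hx => hqs x (by simpa using hx), ?_⟩
    rw [← Walk.length_map (Embedding.induce (A i)).toHom, Walk.map_induce]
    simpa using hq
  · intro i j hij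
    rcases (SimpleGraph.fromRel_adj _ _ _).mp hij with ⟨-, h | ⟨a, ha, b, hb, hab⟩⟩
    · exact h
    · exact ⟨b, hb, a, ha, hab.symm⟩
  · set P := (W ×ˢ W).filter fun x => G.Adj x.1 x.2 with hP
    have hPcard : 2 * W.card + T.card ≤ P.card := by
      have h1 : P.card = ∑ v ∈ W, (N v).card := by
        rw [hP, Finset.card_filter, Finset.sum_product]
        exact Finset.sum_congr rfl fun v _ => by rw [hN, Finset.card_filter]
      rw [h1]
      refine le_trans (le_of_eq ?_) (Finset.sum_le_sum hNT)
      rw [Finset.sum_add_distrib, Finset.sum_const, smul_eq_mul, ← Finset.card_filter,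
        Finset.filter_mem_eq_inter, Finset.inter_eq_right.mpr hTW, mul_comm]
    have hint : (P.filter fun x => root x.1 = root x.2).card ≤ 2 * (W.card - T.card) := by
      have hsub : (P.filter fun x => root x.1 = root x.2) ⊆
          (W \ T).image (fun x => (x, par x)) ∪ (W \ T).image (fun x => (par x, x)) := by
        rintro ⟨a, b⟩ hx
        simp only [hP, Finset.mem_filter, Finset.mem_product] at hx
        obtain ⟨⟨⟨ha, hb⟩, hab⟩, hr⟩ := hx
        obtain ⟨x, hx, hxT, hxe⟩ := hinternal a ha b hb hab hr
        simp only [Finset.mem_union, Finset.mem_image, Finset.mem_sdiff, Prod.mk.injEq]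
        rcases Sym2.eq_iff.mp hxe with ⟨rfl, rfl⟩ | ⟨rfl, rfl⟩
        · exact Or.inl ⟨_, ⟨hx, hxT⟩, rfl, rfl⟩
        · exact Or.inr ⟨_, ⟨hx, hxT⟩, rfl, rfl⟩
      refine (Finset.card_le_card hsub).trans ((Finset.card_union_le _ _).trans ?_)
      rw [← Finset.card_sdiff_of_subset hTW, two_mul]
      exact Nat.add_le_add Finset.card_image_le Finset.card_image_le
    have hsplit := Finset.card_filter_add_card_filter_not (s := P)
      (fun x => root x.1 = root x.2)
    have hTW' := Finset.card_le_card hTW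
    have hedges : (P.filter fun x => ¬ root x.1 = root x.2).card ≤ 2 * Nat.card H.edgeSet := by
      rw [two_mul_card_edgeSet]
      refine Finset.card_le_card_of_injOn (fun x => (ψ x.1, ψ x.2)) ?_ ?_
      · rintro ⟨a, b⟩ hx
        simp only [hP, Finset.coe_filter, Finset.mem_filter, Finset.mem_product,
          Set.mem_ofPred_eq] at hx
        obtain ⟨⟨⟨ha, hb⟩, hab⟩, hr⟩ := hx
        simp only [Finset.coe_filter, Finset.mem_product, Finset.mem_univ, true_and,
          Set.mem_ofPred_eq]
        refine (SimpleGraph.fromRel_adj _ _ _).mpr ⟨fun h => hr (hψroot a ha b hb h), Or.inl ?_⟩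
        exact ⟨a, ⟨ha, (hψ a ha).symm⟩, b, ⟨hb, (hψ b hb).symm⟩, hab⟩
      · rintro ⟨a, b⟩ hx ⟨a', b'⟩ hx' heq
        simp only [hP, Finset.coe_filter, Finset.mem_filter, Finset.mem_product,
          Set.mem_ofPred_eq] at hx hx'
        obtain ⟨⟨⟨ha, hb⟩, hab⟩, hr⟩ := hx
        obtain ⟨⟨⟨ha', hb'⟩, hab'⟩, -⟩ := hx'
        rw [Prod.mk.injEq] at heq
        obtain ⟨rfl, rfl⟩ := hcross a ha b hb hab hr a' ha' b' hb' hab'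
          (hψroot a' ha' a ha heq.1.symm) (hψroot b' hb' b hb heq.2.symm)
        rfl
    omega

/-- A graph of large girth without dense shallow minors has an apex levelling. -/
theorem exists_isApexLevelling {V : Type*} [DecidableEq V] {G : SimpleGraph V} (p : ℕ)
    (hgirth : ((8 * p + 2 : ℕ) : ℕ∞) < G.egirth)
    (hsparse : ∀ (h : ℕ) (H : SimpleGraph (Fin h)), 0 < h → G.IsShallowMinor (2 * p) H →
      2 * Nat.card H.edgeSet < 3 * h) (W : Finset V) :
    ∃ X ℓ, G.IsApexLevelling p W X ℓ := by
  induction W using Finset.strongInduction with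
  | H W ih =>
  rcases W.eq_empty_or_nonempty with rfl | hne
  · refine ⟨∅, fun _ => 0, by simp, by simp, by simp, by simp⟩
  by_cases hleaf : ∃ v ∈ W, ∃ u, ∀ w ∈ W, G.Adj v w → w = u
  · obtain ⟨v, hv, u, hu⟩ := hleaf
    obtain ⟨X, ℓ, h⟩ := ih (W.erase v) (Finset.erase_ssubset hv)
    have := h.insert_leaf (u := u) (Finset.notMem_erase v W)
      fun w hw => hu w (Finset.mem_of_mem_erase hw)
    rw [Finset.insert_erase hv] at this
    exact ⟨_, _, this⟩
  push Not at hleaf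
  by_cases hear : ∀ e : ℕ → V, (∀ i, e i ∈ W) → (∀ i, G.Adj (e i) (e (i + 1))) →
      (∀ i, e (i + 2) ≠ e i) →
      ∃ i ≤ 2 * p, ∃ w ∈ W, G.Adj (e (i + 1)) w ∧ w ≠ e i ∧ w ≠ e (i + 2)
  · obtain ⟨h, H, hpos, hminor, hcard⟩ := exists_dense_shallowMinor (2 * p) hne
      (by rwa [show 4 * (2 * p) + 2 = 8 * p + 2 by omega]) hleaf hear
    have := hsparse h H hpos hminor
    omega
  push Not at hear
  obtain ⟨e, heW, hadj, hnb, hdeg⟩ := hear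
  have hinj : Set.InjOn e (Set.Icc 0 (2 * p + 2)) := injOn_of_lt_egirth e hadj hnb
    (lt_of_le_of_lt (by exact_mod_cast (by omega)) hgirth)
  obtain ⟨X, ℓ, h⟩ := ih (W \ (Finset.Icc 1 (2 * p + 1)).image e) (Finset.sdiff_ssubset
    (fun w hw => by obtain ⟨i, -, rfl⟩ := Finset.mem_image.mp hw; exact heW i) (by simp))
  refine IsApexLevelling.insert_ear e hinj (fun i _ => heW i) (fun i hi w hw hiw => ?_) h
  rw [Finset.mem_Icc] at hi
  obtain ⟨j, rfl⟩ : ∃ j, i = j + 1 := ⟨i - 1, by omega⟩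
  exact or_iff_not_imp_left.mpr (hdeg j (by omega) w hw hiw)

/-- An apex levelling of the whole graph yields a coloring with `p + 2` colors as in the
definition of `chiP`. -/
theorem IsApexLevelling.chiP_le {V : Type*} [Fintype V] [DecidableEq V] {G : SimpleGraph V}
    {p : ℕ} {X : Finset V} {ℓ : V → ℕ} (h : G.IsApexLevelling p Finset.univ X ℓ) :
    G.chiP p ≤ p + 2 := by
  have hlt : ∀ v, (if v ∈ X then p + 1 else ℓ v % (p + 1)) < p + 2 := by
    intro v
    have := Nat.mod_lt (ℓ v) (show 0 < p + 1 by omega)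
    split_ifs <;> omega
  refine Nat.sInf_le ⟨fun v => ⟨_, hlt v⟩, fun i hi s hs => ?_⟩
  set c : V → ℕ := fun v => if v ∈ X then p + 1 else ℓ v % (p + 1) with hc
  set U : Finset V := Finset.univ.filter fun v => (⟨c v, hlt v⟩ : Fin (p + 2)) ∈ s with hU
  have hUcard : (U.image c).card ≤ i := by
    rw [← hs, ← Finset.card_image_of_injective s Fin.val_injective]
    refine Finset.card_le_card fun k hk => ?_
    obtain ⟨v, hv, rfl⟩ := Finset.mem_image.mp hk
    exact Finset.mem_image.mpr ⟨_, (Finset.mem_filter.mp hv).2, rfl⟩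
  obtain ⟨lt, -, htr, hirr, hch, hedge, hsz⟩ := exists_forest_order G c p
    (fun A => h.exists_unique_color c (fun v hv => by simp [hc, hv]) (fun v hv => by simp [hc, hv])
      (Finset.subset_univ A)) U (hUcard.trans hi)
  have hmem : ∀ v : {v | (⟨c v, hlt v⟩ : Fin (p + 2)) ∈ s}, (v : V) ∈ U := fun v =>
    Finset.mem_filter.mpr ⟨Finset.mem_univ _, v.2⟩
  refine Nat.sInf_le ⟨fun u v => lt u v, fun x y z => htr x y z, fun x => hirr x,
    fun x y z hx hy => ?_, fun u v huv => hedge u (hmem u) v (hmem v) huv, fun S hS => ?_⟩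
  · simpa only [Subtype.ext_iff] using hch x y z hx hy
  · rw [← Finset.card_map (Function.Embedding.subtype _)]
    refine (hsz _ (fun x hx => ?_) fun x hx y hy => ?_).trans hUcard
    · obtain ⟨v, -, rfl⟩ := Finset.mem_map.mp hx
      exact hmem v
    · obtain ⟨v, hv, rfl⟩ := Finset.mem_map.mp hx
      obtain ⟨w, hw, rfl⟩ := Finset.mem_map.mp hy
      have hvw := hS v hv w hw
      rw [Subtype.ext_iff] at hvw
      exact hvw

end SimpleGraph

/-- Small expansion at depth `2 * p` bounds the density of shallow minors. -/
theorem GraphClass.two_mul_card_edgeSet_lt {C : GraphClass} {p : ℕ} (hp : 0 < p)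
    (hC : ENNReal.log (C.expansion (2 * p)) / ((2 * p : ℕ) : EReal)
      ≤ ((1 / (10 * ((p : ℝ) + 1)) : ℝ) : EReal))
    {G : (n : ℕ) × SimpleGraph (Fin n)} (hG : G ∈ C) (h : ℕ) (H : SimpleGraph (Fin h))
    (hh : 0 < h) (hH : G.2.IsShallowMinor (2 * p) H) :
    2 * Nat.card H.edgeSet < 3 * h := by
  by_contra hcon
  push Not at hcon
  have hhR : (0 : ℝ) < h := by exact_mod_cast hh
  have hpR : (1 : ℝ) ≤ p := by exact_mod_cast hp
  have h1 : ENNReal.ofReal (3 / 2) ≤ C.expansion (2 * p) := by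
    calc ENNReal.ofReal (3 / 2) ≤ ENNReal.ofReal ((Nat.card H.edgeSet : ℝ) / h) := by
          refine ENNReal.ofReal_le_ofReal ?_
          rw [div_le_div_iff₀ (by norm_num) hhR]
          have : ((3 * h : ℕ) : ℝ) ≤ (2 * Nat.card H.edgeSet : ℕ) := by exact_mod_cast hcon
          push_cast at this
          linarith
      _ = (Nat.card H.edgeSet : ℝ≥0∞) / (h : ℝ≥0∞) := by
          rw [ENNReal.ofReal_div_of_pos hhR, ENNReal.ofReal_natCast, ENNReal.ofReal_natCast]
      _ ≤ SimpleGraph.nabla G.2 (2 * p) := le_sSup ⟨h, H, hh, hH, rfl⟩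
      _ ≤ C.expansion (2 * p) := le_sSup ⟨G, hG, rfl⟩
  have h2 := (EReal.div_le_div_right_of_nonneg (c := ((2 * p : ℕ) : EReal)) (by positivity)
    (ENNReal.log_monotone h1)).trans hC
  rw [ENNReal.log_ofReal_of_pos (by norm_num), ← EReal.coe_natCast, ← EReal.coe_div,
    EReal.coe_le_coe_iff, div_le_div_iff₀ (by positivity) (by positivity)] at h2
  have h3 : (1 : ℝ) / 3 ≤ Real.log (3 / 2) := by
    have := Real.one_sub_inv_le_log_of_pos (show (0 : ℝ) < 3 / 2 by norm_num)
    norm_num at this ⊢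
    exact this
  push_cast at h2
  nlinarith

theorem chiP_of_large_girth
    (C : GraphClass) (p : ℕ) (hp : 0 < p)
    (h : ∀ r : ℕ, 0 < r →
      ENNReal.log (C.expansion r) / (r : EReal)
        ≤ ((1 / (10 * ((p : ℝ) + 1)) : ℝ) : EReal)) :
    ∃ g : ℕ, ∀ G ∈ C, (g : ℕ∞) ≤ (Sigma.snd G).egirth →
      (Sigma.snd G).chiP p ≤ p + 2 := by
  refine ⟨8 * p + 3, fun G hG hgirth => ?_⟩
  obtain ⟨X, ℓ, hX⟩ := SimpleGraph.exists_isApexLevelling (G := G.2) p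
    (lt_of_lt_of_le (by exact_mod_cast Nat.lt_succ_self _) hgirth)
    (fun k H hk hH => GraphClass.two_mul_card_edgeSet_lt hp
      (h (2 * p) (by omega)) hG k H hk hH) Finset.univ
  exact hX.chiP_le
end

section
/- For every integer n ≥ 4 and every real ε > 0, there is an integer g such that every K_n-minor-free finite simple graph G with girth at least g has circular chromatic number χ_c(G) ≤ 2 + ε. -/
open SimpleGraph ENNReal

universe u

/-- The vertex set `S` of `G` contains the branch sets of a complete minor on `n` vertices. -/
def SimpleGraph.HasCliqueMinorIn {V : Type u} (G : SimpleGraph V) (S : Set V) (n : ℕ) : Prop :=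
  ∃ A : Fin n → Set V,
    (Pairwise fun i j => Disjoint (A i) (A j)) ∧
    (∀ i, (G.induce (A i)).Connected) ∧ (∀ i, A i ⊆ S) ∧
    ∀ i j, i ≠ j → ∃ a ∈ A i, ∃ b ∈ A j, G.Adj a b

lemma SimpleGraph.HasCliqueMinorIn.mono {V : Type u} {G : SimpleGraph V} {S T : Set V} {n : ℕ}
    (h : G.HasCliqueMinorIn S n) (hST : S ⊆ T) : G.HasCliqueMinorIn T n := by
  obtain ⟨A, h1, h2, h3, h4⟩ := h
  exact ⟨A, h1, h2, fun i => (h3 i).trans hST, h4⟩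

/-- A connected set dominating a set with a `K_n` minor yields a `K_{n+1}` minor. -/
lemma SimpleGraph.HasCliqueMinorIn.cons {V : Type u} {G : SimpleGraph V} {S T U : Set V} {n : ℕ}
    (h : G.HasCliqueMinorIn T n) (hU : (G.induce U).Connected) (hUS : U ⊆ S) (hTS : T ⊆ S)
    (hUT : Disjoint U T) (hadj : ∀ t ∈ T, ∃ u ∈ U, G.Adj u t) :
    G.HasCliqueMinorIn S (n + 1) := by
  obtain ⟨A, h1, h2, h3, h4⟩ := h
  have key : ∀ i, ∃ a ∈ U, ∃ b ∈ A i, G.Adj a b := by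
    intro i
    obtain ⟨⟨b, hb⟩⟩ := (h2 i).nonempty
    obtain ⟨u, hu, hub⟩ := hadj b (h3 i hb)
    exact ⟨u, hu, b, hb, hub⟩
  refine ⟨Fin.cons U A, ?_, ?_, ?_, ?_⟩
  · intro i j hij
    induction i using Fin.cases with
    | zero =>
      induction j using Fin.cases with
      | zero => exact absurd rfl hij
      | succ j => exact hUT.mono_right (h3 j)
    | succ i =>
      induction j using Fin.cases with
      | zero => exact (hUT.mono_right (h3 i)).symm
      | succ j => exact h1 (ne_of_apply_ne Fin.succ hij)
  · intro i
    induction i using Fin.cases with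
    | zero => exact hU
    | succ i => exact h2 i
  · intro i
    induction i using Fin.cases with
    | zero => exact hUS
    | succ i => exact (h3 i).trans hTS
  · intro i j hij
    induction i using Fin.cases with
    | zero =>
      induction j using Fin.cases with
      | zero => exact absurd rfl hij
      | succ j => exact key j
    | succ i =>
      induction j using Fin.cases with
      | zero =>
        obtain ⟨a, ha, b, hb, hab⟩ := key i
        exact ⟨b, hb, a, ha, hab.symm⟩
      | succ j => exact h4 i j (ne_of_apply_ne Fin.succ hij)

section EdgeCount

variable {V : Type u} [DecidableEq V] (G : SimpleGraph V) [DecidableRel G.Adj]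

/-- The neighbours of `v` inside `S`. -/
def SimpleGraph.neighborsIn (S : Finset V) (v : V) : Finset V := {w ∈ S | G.Adj v w}

/-- The sum of the degrees of the subgraph induced on `S`. -/
def SimpleGraph.degreeSum (S : Finset V) : ℕ := ∑ v ∈ S, (G.neighborsIn S v).card

/-- The vertices of `S` outside `U` with a neighbour in `U`. -/
def SimpleGraph.boundaryIn (S U : Finset V) : Finset V := {w ∈ S \ U | ∃ u ∈ U, G.Adj u w}

lemma SimpleGraph.degreeSum_le_erase (S : Finset V) {v : V} (hv : v ∈ S) :
    G.degreeSum S ≤ G.degreeSum (S.erase v) + 2 * (G.neighborsIn S v).card := by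
  unfold degreeSum
  rw [← Finset.add_sum_erase S _ hv]
  have h : ∀ w ∈ S.erase v, (G.neighborsIn S w).card
      ≤ (G.neighborsIn (S.erase v) w).card + if G.Adj v w then 1 else 0 := by
    intro w hw
    split_ifs with hvw
    · have : G.neighborsIn S w ⊆ insert v (G.neighborsIn (S.erase v) w) := by
        intro x hx
        simp only [neighborsIn, Finset.mem_filter, Finset.mem_insert, Finset.mem_erase] at hx ⊢
        tauto
      exact (Finset.card_le_card this).trans (Finset.card_insert_le _ _)
    · apply Finset.card_le_card
      intro x hx
      simp only [neighborsIn, Finset.mem_filter, Finset.mem_erase] at hx ⊢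
      refine ⟨⟨?_, hx.1⟩, hx.2⟩
      rintro rfl
      exact hvw hx.2.symm
  have h2 := Finset.sum_le_sum h
  rw [Finset.sum_add_distrib] at h2
  have h3 : ∑ w ∈ S.erase v, (if G.Adj v w then 1 else 0) ≤ (G.neighborsIn S v).card := by
    rw [← Finset.sum_filter, ← Finset.card_eq_sum_ones]
    exact Finset.card_le_card (Finset.filter_subset_filter _ (Finset.erase_subset _ _))
  omega

/-- Every nonempty set of minimum degree at least `2 ^ n` contains a `K_n` minor. -/
theorem SimpleGraph.hasCliqueMinorIn_of_two_pow_le_degree (n : ℕ) (S : Finset V)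
    (hS : S.Nonempty) (hdeg : ∀ v ∈ S, 2 ^ n ≤ (G.neighborsIn S v).card) :
    G.HasCliqueMinorIn S n := by
  induction n generalizing S with
  | zero =>
    exact ⟨fun i => i.elim0, fun i => i.elim0, fun i => i.elim0, fun i => i.elim0,
      fun i => i.elim0⟩
  | succ n ih =>
    induction S using Finset.strongInduction with
    | H S ihS =>
    let P : Finset V → Prop := fun U => (G.induce (U : Set V)).Connected ∧
      2 * 2 ^ n * ((S \ U).card + 1) ≤ G.degreeSum (S \ U) + 2 * (G.boundaryIn S U).card
    obtain ⟨v₀, hv₀⟩ := hS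
    have hne : ∃ U, U ⊆ S ∧ P U := by
      refine ⟨{v₀}, by simpa using hv₀, ?_, ?_⟩
      · rw [Finset.coe_singleton]
        exact ⟨fun a b => by rw [Subsingleton.elim a b]⟩
      · have h1 : 2 * 2 ^ n * S.card ≤ G.degreeSum S := by
          unfold degreeSum
          rw [mul_comm, ← smul_eq_mul]
          apply Finset.card_nsmul_le_sum
          intro v hv
          simpa [pow_succ, mul_comm] using hdeg v hv
        have h2 : S \ {v₀} = S.erase v₀ := by
          ext x; simp [and_comm]
        have h3 : G.boundaryIn S {v₀} = G.neighborsIn S v₀ := by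
          ext x
          simp only [boundaryIn, neighborsIn, Finset.mem_filter, Finset.mem_sdiff,
            Finset.mem_singleton, exists_eq_left]
          constructor
          · tauto
          · rintro ⟨h, h'⟩
            exact ⟨⟨h, h'.ne'⟩, h'⟩
        rw [h2, h3, Finset.card_erase_add_one hv₀]
        exact h1.trans (G.degreeSum_le_erase S hv₀)
    classical
    obtain ⟨U, hUmem, hUmax⟩ := Finset.exists_max_image (S.powerset.filter P) Finset.card (by
      obtain ⟨U, h1, h2⟩ := hne
      exact ⟨U, by simp [h1, h2]⟩)
    simp only [Finset.mem_filter, Finset.mem_powerset] at hUmem hUmax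
    obtain ⟨hUS, hUc, hUe⟩ := hUmem
    have hUne : U.Nonempty := by
      obtain ⟨⟨b, hb⟩⟩ := hUc.nonempty
      exact ⟨b, hb⟩
    by_cases hN : (G.boundaryIn S U).Nonempty
    · have hmin : ∀ w ∈ G.boundaryIn S U,
          2 ^ n ≤ (G.neighborsIn (G.boundaryIn S U) w).card := by
        intro w hw
        by_contra hlt
        push Not at hlt
        have hw' := hw
        simp only [boundaryIn, Finset.mem_filter, Finset.mem_sdiff] at hw'
        obtain ⟨⟨hwS, hwU⟩, u, huU, huw⟩ := hw'
        have hwSU : w ∈ S \ U := Finset.mem_sdiff.2 ⟨hwS, hwU⟩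
        have hsd : S \ insert w U = (S \ U).erase w := by
          ext x; simp only [Finset.mem_sdiff, Finset.mem_insert, Finset.mem_erase]; tauto
        have hnot : ¬ P (insert w U) := by
          intro hP
          have := hUmax (insert w U) ⟨Finset.insert_subset hwS hUS, hP⟩
          rw [Finset.card_insert_of_notMem hwU] at this
          omega
        apply hnot
        refine ⟨?_, ?_⟩
        · rw [Finset.coe_insert, Set.insert_eq, Set.union_comm]
          refine connected_induce_union hUc.preconnected ?_ huU (Set.mem_singleton w) huw
          intro a b
          rw [Subsingleton.elim a b]
        · rw [hsd, Finset.card_erase_add_one hwSU]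
          have h1 := G.degreeSum_le_erase (S \ U) hwSU
          have h2 : G.boundaryIn S U ∪ G.neighborsIn (S \ U) w
              ⊆ insert w (G.boundaryIn S (insert w U)) := by
            intro x hx
            simp only [boundaryIn, neighborsIn, Finset.mem_union, Finset.mem_filter,
              Finset.mem_sdiff, Finset.mem_insert] at hx ⊢
            by_cases hxw : x = w
            · exact Or.inl hxw
            · right
              rcases hx with ⟨⟨h1, h2⟩, u', h3, h4⟩ | ⟨⟨h1, h2⟩, h3⟩
              · exact ⟨⟨h1, by tauto⟩, u', Or.inr h3, h4⟩
              · exact ⟨⟨h1, by tauto⟩, w, Or.inl rfl, h3⟩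
          have h3 := (Finset.card_le_card h2).trans (Finset.card_insert_le _ _)
          have h4 := Finset.card_union_add_card_inter (G.boundaryIn S U)
            (G.neighborsIn (S \ U) w)
          have h5 : G.boundaryIn S U ∩ G.neighborsIn (S \ U) w
              ⊆ G.neighborsIn (G.boundaryIn S U) w := by
            intro x hx
            simp only [neighborsIn, Finset.mem_inter, Finset.mem_filter] at hx ⊢
            tauto
          have h6 := Finset.card_le_card h5
          rw [mul_add] at hUe
          omega
      refine (ih _ hN hmin).cons hUc (by exact_mod_cast hUS) ?_ ?_ ?_
      · intro x hx
        simp only [boundaryIn, Finset.coe_filter, Finset.mem_sdiff, Set.mem_ofPred_eq] at hx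
        exact hx.1.1
      · rw [Finset.disjoint_coe, Finset.disjoint_left]
        intro x hx hx'
        simp only [boundaryIn, Finset.mem_filter, Finset.mem_sdiff] at hx'
        exact hx'.1.2 hx
      · intro t ht
        simp only [boundaryIn, Finset.coe_filter, Finset.mem_sdiff, Set.mem_ofPred_eq] at ht
        exact ht.2
    · rw [Finset.not_nonempty_iff_eq_empty] at hN
      have hSU : (S \ U).Nonempty := by
        rw [Finset.nonempty_iff_ne_empty]
        intro h0
        rw [hN, h0] at hUe
        simp [degreeSum] at hUe
      refine (ihS (S \ U) ?_ hSU ?_).mono (by exact_mod_cast Finset.sdiff_subset)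
      · exact Finset.sdiff_ssubset hUS hUne
      · intro v hv
        refine (hdeg v (Finset.mem_sdiff.1 hv).1).trans (Finset.card_le_card ?_)
        intro x hx
        simp only [neighborsIn, Finset.mem_filter, Finset.mem_sdiff] at hx ⊢
        refine ⟨⟨hx.1, fun hxU => ?_⟩, hx.2⟩
        have : v ∈ G.boundaryIn S U := by
          simp only [boundaryIn, Finset.mem_filter]
          exact ⟨hv, x, hxU, hx.2.symm⟩
        rw [hN] at this
        simp at this

end EdgeCount

section Girth

variable {V : Type u} {G : SimpleGraph V}

/-- An edge together with a walk between its ends avoiding it bounds the girth. -/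
lemma SimpleGraph.egirth_le_of_walk_avoiding {u v : V} (h : G.Adj u v) (p : G.Walk v u)
    (hp : s(u, v) ∉ p.edges) : G.egirth ≤ (p.length + 1 : ℕ) := by
  classical
  have hc : (Walk.cons h p.bypass).IsCycle :=
    (Walk.cons_isCycle_iff _ _).2
      ⟨p.bypass_isPath, fun h' => hp (p.edges_bypass_subset_edges h')⟩
  refine (egirth_le_length hc).trans ?_
  have := p.length_bypass_le_length
  rw [Walk.length_cons]
  exact_mod_cast Nat.succ_le_succ this

/-- The walk along consecutive terms of a sequence of adjacent vertices. -/
lemma SimpleGraph.exists_walk_of_seq_s9 (x : ℕ → V) (hx : ∀ i, G.Adj (x i) (x (i + 1))) (a m : ℕ) :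
    ∃ p : G.Walk (x a) (x (a + m)), p.length = m ∧
      ∀ e ∈ p.edges, ∃ k, a ≤ k ∧ k < a + m ∧ e = s(x k, x (k + 1)) := by
  induction m with
  | zero => exact ⟨Walk.nil, rfl, by simp⟩
  | succ m ih =>
    obtain ⟨p, hp, he⟩ := ih
    refine ⟨p.concat (hx (a + m)), by simp [hp], ?_⟩
    intro e h
    rw [Walk.edges_concat, List.concat_eq_append, List.mem_append, List.mem_singleton] at h
    rcases h with h | h
    · obtain ⟨k, h1, h2, h3⟩ := he e h
      exact ⟨k, h1, by omega, h3⟩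
    · exact ⟨a + m, by omega, by omega, h⟩

/-- A non-backtracking sequence cannot close up in fewer steps than the girth. -/
lemma SimpleGraph.seq_ne_of_lt_egirth (x : ℕ → V) (hx : ∀ i, G.Adj (x i) (x (i + 1)))
    (hnb : ∀ i, x (i + 2) ≠ x i) (m : ℕ) (hm : 0 < m) (hg : (m : ℕ∞) < G.egirth) (a : ℕ) :
    x a ≠ x (a + m) := by
  induction m using Nat.strong_induction_on generalizing a with
  | _ m ih =>
  intro heq
  have hdist : ∀ i j, a ≤ i → i < j → j ≤ a + m → j - i < m → x i ≠ x j := by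
    intro i j h1 h2 h3 h4
    have := ih (j - i) h4 (by omega) (lt_of_le_of_lt (by exact_mod_cast h4.le) hg) i
    rwa [show i + (j - i) = j by omega] at this
  obtain ⟨p, hp, he⟩ := exists_walk_of_seq_s9 x hx (a + 1) (m - 1)
  have hend : x (a + 1 + (m - 1)) = x a := by rw [heq]; congr 1; omega
  have hnot : s(x a, x (a + 1)) ∉ (p.copy rfl hend).edges := by
    rw [Walk.edges_copy]
    intro h
    obtain ⟨k, h1, h2, h3⟩ := he _ h
    rw [Sym2.eq_iff] at h3
    rcases h3 with ⟨h3, -⟩ | ⟨h3, h4⟩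
    · exact hdist a k le_rfl (by omega) (by omega) (by omega) h3
    · by_cases hk : k = a + 1
      · subst hk
        exact hnb a h3.symm
      · exact hdist (a + 1) k (by omega) (by omega) (by omega) (by omega) h4
  have := egirth_le_of_walk_avoiding (hx a) _ hnot
  rw [Walk.length_copy, hp, Nat.sub_add_cancel hm] at this
  exact absurd hg (not_lt.2 this)

/-- Minimum degree two allows non-backtracking sequences from every vertex. -/
lemma SimpleGraph.exists_nonbacktracking_seq_s9 [Fintype V] [DecidableRel G.Adj]
    (hdeg : ∀ v, 2 ≤ G.degree v) (z : V) :
    ∃ x : ℕ → V, x 0 = z ∧ (∀ i, G.Adj (x i) (x (i + 1))) ∧ ∀ i, x (i + 2) ≠ x i := by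
  have hnext : ∀ u v : V, ∃ w, G.Adj v w ∧ w ≠ u := by
    intro u v
    obtain ⟨w, hw, hwu⟩ := Finset.exists_mem_ne (s := G.neighborFinset v)
      (by rw [card_neighborFinset_eq_degree]; exact hdeg v) u
    exact ⟨w, by simpa using hw, hwu⟩
  choose next hadj hne using hnext
  let y : ℕ → V × V := fun i => Nat.rec (z, next z z) (fun _ q => (q.2, next q.1 q.2)) i
  have hy : ∀ i, y (i + 1) = ((y i).2, next (y i).1 (y i).2) := fun i => rfl
  refine ⟨fun i => (y i).1, rfl, ?_, ?_⟩
  · intro i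
    simp only [hy]
    cases i with
    | zero => exact hadj z z
    | succ i => exact hadj _ _
  · intro i
    simp only [hy]
    exact hne _ _

end Girth

section Voronoi

variable {V : Type u} [Fintype V]

/-- A rooted spanning forest of trees of height at most `2 * r`, each of which contains the ball
of radius `r` around its root: `c` sends a vertex to its root and `π` to its parent. -/
lemma SimpleGraph.exists_voronoi_forest (G : SimpleGraph V) (r : ℕ) :
    ∃ (c π : V → V),
      (∀ v, c (c v) = c v) ∧
      (∀ v, ∃ p : G.Walk v (c v), p.length ≤ 2 * r ∧
        (∀ e ∈ p.edges, ∃ x, e = s(x, π x) ∧ c x = c v ∧ c (π x) = c v) ∧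
        ∀ x ∈ p.support, c x = c v) ∧
      (∀ z v, c z = z → ∀ p : G.Walk z v, p.length ≤ r → c v = z) := by
  classical
  let P : Finset V → Prop := fun Z =>
    ∀ z ∈ Z, ∀ z' ∈ Z, z ≠ z' → ∀ p : G.Walk z z', 2 * r < p.length
  obtain ⟨Z, hZmem, hZmax⟩ := Finset.exists_max_image
    ((Finset.univ : Finset (Finset V)).filter P) Finset.card ⟨∅, by simp [P]⟩
  simp only [Finset.mem_filter, Finset.mem_univ, true_and] at hZmem hZmax
  have hcover : ∀ v, ∃ z ∈ Z, ∃ p : G.Walk v z, p.length ≤ 2 * r := by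
    intro v
    by_contra! hcon
    have hv : v ∉ Z := fun hv => absurd (hcon v hv Walk.nil) (by simp)
    have hP : P (insert v Z) := by
      intro z hz z' hz' hne p
      rw [Finset.mem_insert] at hz hz'
      rcases hz with rfl | hz <;> rcases hz' with rfl | hz'
      · exact absurd rfl hne
      · exact hcon _ hz' p
      · simpa using hcon _ hz p.reverse
      · exact hZmem z hz z' hz' hne p
    have := hZmax _ hP
    rw [Finset.card_insert_of_notMem hv] at this
    omega
  have hex : ∀ v, ∃ l, ∃ z ∈ Z, ∃ p : G.Walk v z, p.length = l := by
    intro v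
    obtain ⟨z, hz, p, -⟩ := hcover v
    exact ⟨_, z, hz, p, rfl⟩
  let ρ : V → ℕ := fun v => Nat.find (hex v)
  have hρle : ∀ v, ∀ z ∈ Z, ∀ p : G.Walk v z, ρ v ≤ p.length :=
    fun v z hz p => Nat.find_min' (hex v) ⟨z, hz, p, rfl⟩
  have hρ2r : ∀ v, ρ v ≤ 2 * r := by
    intro v
    obtain ⟨z, hz, p, hp⟩ := hcover v
    exact (hρle v z hz p).trans hp
  have hparent : ∀ v, ∃ w, (v ∈ Z → w = v) ∧ (v ∉ Z → G.Adj v w ∧ ρ w < ρ v) := by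
    intro v
    by_cases hv : v ∈ Z
    · exact ⟨v, fun _ => rfl, fun h => absurd hv h⟩
    · obtain ⟨z, hz, p, hp⟩ := Nat.find_spec (hex v)
      cases p with
      | nil => exact absurd hz hv
      | @cons _ w _ h q =>
        refine ⟨w, fun h' => absurd h' hv, fun _ => ⟨h, ?_⟩⟩
        have h1 := hρle w z hz q
        have h2 : q.length + 1 = ρ v := hp
        omega
  choose π hπZ hπ using hparent
  have hiter : ∀ m v, ρ v ≤ m → π^[m] v ∈ Z := by
    intro m
    induction m with
    | zero =>
      intro v hv
      by_contra hvZ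
      have := (hπ v (by simpa using hvZ)).2
      omega
    | succ m ih =>
      intro v hv
      rw [Function.iterate_succ_apply]
      by_cases hvZ : v ∈ Z
      · rw [hπZ v hvZ]
        have : π^[m] v = v := Function.iterate_fixed (hπZ v hvZ) m
        rwa [this]
      · have := (hπ v hvZ).2
        exact ih _ (by omega)
  let c : V → V := fun v => π^[2 * r] v
  have hcZ : ∀ v, c v ∈ Z := fun v => hiter _ _ (hρ2r v)
  have hcfix : ∀ z ∈ Z, c z = z := fun z hz => Function.iterate_fixed (hπZ z hz) _
  have hcπ : ∀ v, c (π v) = c v := by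
    intro v
    change π^[2 * r] (π v) = π^[2 * r] v
    rw [← Function.iterate_succ_apply, Function.iterate_succ_apply']
    exact hπZ _ (hcZ v)
  have hwalk : ∀ m v, ρ v ≤ m → ∃ p : G.Walk v (c v), p.length ≤ ρ v ∧
      (∀ e ∈ p.edges, ∃ x, e = s(x, π x) ∧ c x = c v ∧ c (π x) = c v) ∧
      ∀ x ∈ p.support, c x = c v := by
    intro m
    induction m with
    | zero =>
      intro v hv
      have hvZ : v ∈ Z := by
        by_contra hvZ
        have := (hπ v hvZ).2
        omega
      refine ⟨(Walk.nil : G.Walk v v).copy rfl (hcfix v hvZ).symm, by simp, by simp, by simp⟩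
    | succ m ih =>
      intro v hv
      by_cases hvZ : v ∈ Z
      · exact ⟨(Walk.nil : G.Walk v v).copy rfl (hcfix v hvZ).symm, by simp, by simp, by simp⟩
      · obtain ⟨hadj, hlt⟩ := hπ v hvZ
        obtain ⟨p, h1, h2, h3⟩ := ih (π v) (by omega)
        refine ⟨(Walk.cons hadj p).copy rfl (hcπ v), ?_, ?_, ?_⟩
        · simp only [Walk.length_copy, Walk.length_cons]
          omega
        · intro e he
          simp only [Walk.edges_copy, Walk.edges_cons, List.mem_cons] at he
          rcases he with rfl | he
          · exact ⟨v, rfl, rfl, hcπ v⟩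
          · obtain ⟨x, h4, h5, h6⟩ := h2 e he
            exact ⟨x, h4, h5.trans (hcπ v), h6.trans (hcπ v)⟩
        · intro x hx
          simp only [Walk.support_copy, Walk.support_cons, List.mem_cons] at hx
          rcases hx with rfl | hx
          · rfl
          · exact (h3 x hx).trans (hcπ v)
  refine ⟨c, π, fun v => hcfix _ (hcZ v), ?_, ?_⟩
  · intro v
    obtain ⟨p, h1, h2, h3⟩ := hwalk _ v le_rfl
    exact ⟨p, h1.trans (hρ2r v), h2, h3⟩
  · intro z v hz p hp
    have hzZ : z ∈ Z := hz ▸ hcZ z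
    by_contra hne
    obtain ⟨q, h1, -, -⟩ := hwalk _ v le_rfl
    have h2 := hρle v z hzZ p.reverse
    have h3 := hZmem z hzZ (c v) (hcZ v) (Ne.symm hne) (p.append q)
    simp only [Walk.length_append, Walk.length_reverse] at h2 h3
    omega

end Voronoi

section LargeGirth

variable {V : Type u} {G : SimpleGraph V}

/-- Clique minors lift through the contraction of connected fibres. -/
lemma SimpleGraph.HasCliqueMinorIn.of_contraction {H : SimpleGraph V} {S : Set V} {n : ℕ}
    {c : V → V} (h : H.HasCliqueMinorIn S n) (hS : ∀ z ∈ S, c z = z)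
    (hfib : ∀ v, ∃ p : G.Walk v (c v), ∀ x ∈ p.support, c x = c v)
    (hH : ∀ z z', H.Adj z z' → ∃ v w, G.Adj v w ∧ c v = z ∧ c w = z') :
    G.HasCliqueMinorIn Set.univ n := by
  obtain ⟨A, h1, h2, h3, h4⟩ := h
  refine ⟨fun i => c ⁻¹' A i, ?_, ?_, fun i => Set.subset_univ _, ?_⟩
  · intro i j hij
    exact (h1 hij).preimage c
  · intro i
    have hroot : ∀ v (hv : c v ∈ A i), ∃ hcv : c (c v) ∈ A i,
        (G.induce (c ⁻¹' A i)).Reachable ⟨v, hv⟩ ⟨c v, hcv⟩ := by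
      intro v hv
      obtain ⟨p, hp⟩ := hfib v
      refine ⟨by rwa [hS _ (h3 i hv)], ⟨p.induce _ ?_⟩⟩
      intro x hx
      change c x ∈ A i
      rwa [hp x hx]
    have hstep : ∀ z z' : A i, (H.induce (A i)).Reachable z z' →
        ∀ (hz : c z ∈ A i) (hz' : c z' ∈ A i),
        (G.induce (c ⁻¹' A i)).Reachable ⟨z, hz⟩ ⟨z', hz'⟩ := by
      rintro z z' ⟨p⟩
      induction p with
      | nil => exact fun _ _ => Reachable.rfl
      | @cons a b d hab q ih =>
        intro hz hz'
        have hb : c b ∈ A i := by rw [hS _ (h3 i b.2)]; exact b.2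
        obtain ⟨v, w, hvw, hv, hw⟩ := hH a b hab
        have kv : c v ∈ A i := hv ▸ a.2
        have kw : c w ∈ A i := hw ▸ b.2
        obtain ⟨k1, r1⟩ := hroot v kv
        obtain ⟨k2, r2⟩ := hroot w kw
        have e1 : (⟨c v, k1⟩ : ↑(c ⁻¹' A i)) = ⟨a, hz⟩ := Subtype.ext hv
        have e2 : (⟨c w, k2⟩ : ↑(c ⁻¹' A i)) = ⟨b, hb⟩ := Subtype.ext hw
        rw [e1] at r1
        rw [e2] at r2
        have r3 : (G.induce (c ⁻¹' A i)).Adj ⟨v, kv⟩ ⟨w, kw⟩ := hvw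
        exact (r1.symm.trans (r3.reachable.trans r2)).trans (ih hb hz')
    obtain ⟨z⟩ := (h2 i).nonempty
    rw [connected_iff_exists_forall_reachable]
    have hz : c z ∈ A i := by rw [hS _ (h3 i z.2)]; exact z.2
    refine ⟨⟨z, hz⟩, ?_⟩
    rintro ⟨v, hv⟩
    obtain ⟨k, r⟩ := hroot v hv
    exact (hstep z ⟨c v, hv⟩ ((h2 i).preconnected _ _) hz k).trans r.symm
  · intro i j hij
    obtain ⟨a, ha, b, hb, hab⟩ := h4 i j hij
    obtain ⟨v, w, hvw, hv, hw⟩ := hH a b hab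
    exact ⟨v, by simpa [hv] using ha, w, by simpa [hw] using hb, hvw⟩

/-- If the girth is large, the minimum degree is at least two and vertices of degree at least
three occur at bounded distance along every non-backtracking sequence, then there is a
`K_n` minor. -/
theorem SimpleGraph.hasCliqueMinorIn_of_lt_egirth [Fintype V] [Nonempty V] [DecidableRel G.Adj]
    (n p : ℕ) (hdeg : ∀ v, 2 ≤ G.degree v)
    (hbranch : ∀ x : ℕ → V, (∀ i, G.Adj (x i) (x (i + 1))) → (∀ i, x (i + 2) ≠ x i) →
      ∃ i, 0 < i ∧ i < p ∧ 3 ≤ G.degree (x i))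
    (hg : ((8 * (2 ^ n * p) + 2 : ℕ) : ℕ∞) < G.egirth) :
    G.HasCliqueMinorIn Set.univ n := by
  classical
  set D := 2 ^ n with hD
  set r := D * p with hr
  obtain ⟨c, π, hcc, hwalk, hball⟩ := G.exists_voronoi_forest r
  have hlt : ∀ m : ℕ, G.egirth ≤ m → 8 * r + 2 < m := by
    intro m hm
    exact_mod_cast lt_of_lt_of_le hg hm
  have hint : ∀ v w, G.Adj v w → c v = c w → w = π v ∨ v = π w := by
    intro v w hvw hc
    by_contra! hcon
    obtain ⟨pv, hv1, hv2, -⟩ := hwalk v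
    obtain ⟨pw, hw1, hw2, -⟩ := hwalk w
    have hnot : ∀ x, s(v, w) ≠ s(x, π x) := by
      intro x hx
      rw [Sym2.eq_iff] at hx
      rcases hx with ⟨rfl, h⟩ | ⟨h, rfl⟩
      · exact hcon.1 h
      · exact hcon.2 h
    have := hlt _ (egirth_le_of_walk_avoiding hvw
      (pw.append (pv.reverse.copy hc rfl)) (by
        simp only [Walk.edges_append, Walk.edges_copy, Walk.edges_reverse, List.mem_append,
          List.mem_reverse, not_or]
        constructor
        · intro h
          obtain ⟨x, hx, -⟩ := hw2 _ h
          exact hnot x hx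
        · intro h
          obtain ⟨x, hx, -⟩ := hv2 _ h
          exact hnot x hx))
    simp only [Walk.length_append, Walk.length_copy, Walk.length_reverse] at this
    omega
  have hcross : ∀ v w v' w', G.Adj v w → G.Adj v' w' → c v ≠ c w → c v' = c v → c w' = c w →
      v = v' ∧ w = w' := by
    intro v w v' w' hvw hvw' hne hv hw
    by_contra hcon
    obtain ⟨pv, hv1, hv2, -⟩ := hwalk v
    obtain ⟨pw, hw1, hw2, -⟩ := hwalk w
    obtain ⟨pv', hv1', hv2', -⟩ := hwalk v'
    obtain ⟨pw', hw1', hw2', -⟩ := hwalk w'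
    have hnot : ∀ x, c (π x) = c x → s(v, w) ≠ s(x, π x) := by
      intro x hπ hx
      rw [Sym2.eq_iff] at hx
      rcases hx with ⟨rfl, rfl⟩ | ⟨rfl, rfl⟩
      · exact hne hπ.symm
      · exact hne hπ
    have hnot' : s(v, w) ≠ s(w', v') := by
      intro hx
      rw [Sym2.eq_iff] at hx
      rcases hx with ⟨rfl, rfl⟩ | hx
      · exact hne hw
      · exact hcon hx
    have := hlt _ (egirth_le_of_walk_avoiding hvw
      ((pw.append (pw'.reverse.copy hw rfl)).append
        (Walk.cons hvw'.symm (pv'.append (pv.reverse.copy hv.symm rfl)))) (by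
        simp only [Walk.edges_append, Walk.edges_copy, Walk.edges_reverse, Walk.edges_cons,
          List.mem_append, List.mem_cons, List.mem_reverse]
        rintro ((h | h) | h | h | h)
        · obtain ⟨x, hx, h1, h2⟩ := hw2 _ h
          exact hnot x (h2.trans h1.symm) hx
        · obtain ⟨x, hx, h1, h2⟩ := hw2' _ h
          exact hnot x (h2.trans h1.symm) hx
        · exact hnot' h
        · obtain ⟨x, hx, h1, h2⟩ := hv2' _ h
          exact hnot x (h2.trans h1.symm) hx
        · obtain ⟨x, hx, h1, h2⟩ := hv2 _ h
          exact hnot x (h2.trans h1.symm) hx))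
    simp only [Walk.length_append, Walk.length_copy, Walk.length_reverse,
      Walk.length_cons] at this
    omega
  let H : SimpleGraph V :=
    { Adj := fun z z' => z ≠ z' ∧ ∃ v w, G.Adj v w ∧ c v = z ∧ c w = z'
      symm := ⟨fun z z' ⟨h, v, w, h1, h2, h3⟩ => ⟨h.symm, w, v, h1.symm, h3, h2⟩⟩
      loopless := ⟨fun z h => h.1 rfl⟩ }
  let S : Finset V := {z | c z = z}
  have hbranching : ∀ z ∈ S, D ≤ (Finset.univ.filter fun v => c v = z ∧ 3 ≤ G.degree v).card := by
    intro z hz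
    have hz : c z = z := by simpa [S] using hz
    obtain ⟨x, hx0, hx, hnb⟩ := exists_nonbacktracking_seq_s9 hdeg z
    have hb : ∀ j, ∃ i, j * p < i ∧ i < (j + 1) * p ∧ 3 ≤ G.degree (x i) := by
      intro j
      obtain ⟨i, h1, h2, h3⟩ := hbranch (fun i => x (j * p + i)) (fun i => hx _) (fun i => hnb _)
      exact ⟨j * p + i, by omega, by rw [add_mul]; omega, h3⟩
    choose i hi1 hi2 hi3 using hb
    have hmono : StrictMono i := strictMono_nat_of_lt_succ fun j => (hi2 j).trans (hi1 (j + 1))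
    have hir : ∀ j < D, i j < r := fun j hj => (hi2 j).trans_le (Nat.mul_le_mul_right p hj)
    calc D = (Finset.range D).card := by simp
      _ ≤ _ := Finset.card_le_card_of_injOn (fun j => x (i j)) ?_ ?_
    · intro j hj
      have hj : j < D := by simpa using hj
      simp only [Finset.coe_filter, Finset.mem_univ, true_and]
      refine ⟨?_, hi3 j⟩
      obtain ⟨q, hq, -⟩ := exists_walk_of_seq_s9 x hx 0 (i j)
      have := hball z _ hz (q.copy hx0 rfl) (by rw [Walk.length_copy, hq]; exact (hir j hj).le)
      rwa [Nat.zero_add] at this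
    · have hne : ∀ j k, k < D → j < k → x (i j) ≠ x (i k) := by
        intro j k hk hjk
        have h1 := hmono hjk
        have h2 := hir k hk
        have := seq_ne_of_lt_egirth x hx hnb (i k - i j) (by omega)
          (lt_of_le_of_lt (by exact_mod_cast (by omega : i k - i j ≤ 8 * r + 2)) hg) (i j)
        rwa [show i j + (i k - i j) = i k by omega] at this
      intro j hj k hk hjk
      have hj : j < D := by simpa using hj
      have hk : k < D := by simpa using hk
      rcases lt_trichotomy j k with h | h | h
      · exact absurd hjk (hne j k hk h)
      · exact h
      · exact absurd hjk.symm (hne k j hj h)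
  have hHdeg : ∀ z ∈ S, D ≤ (H.neighborsIn S z).card := by
    intro z hz
    let cell : Finset V := {v | c v = z}
    let darts : Finset (Σ _ : V, V) := cell.sigma fun v => G.neighborFinset v
    let out : Finset (Σ _ : V, V) := darts.filter fun q => c q.2 ≠ z
    have h1 : D + 2 * cell.card ≤ darts.card := by
      have h2 : darts.card = ∑ v ∈ cell, G.degree v := by
        simp [darts, Finset.card_sigma]
      have h3 : ∑ v ∈ cell, (2 + if 3 ≤ G.degree v then 1 else 0) ≤ ∑ v ∈ cell, G.degree v := by
        apply Finset.sum_le_sum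
        intro v _
        have := hdeg v
        split_ifs <;> omega
      rw [Finset.sum_add_distrib, ← Finset.sum_filter, ← Finset.card_eq_sum_ones,
        Finset.sum_const, smul_eq_mul, Finset.filter_filter] at h3
      have := hbranching z hz
      omega
    have h2 : darts ⊆ (cell.image fun v => ⟨v, π v⟩) ∪ (cell.image fun v => ⟨π v, v⟩) ∪ out := by
      rintro ⟨v, w⟩ h
      have h' := h
      simp only [darts, cell, Finset.mem_sigma, Finset.mem_filter, Finset.mem_univ, true_and,
        mem_neighborFinset] at h'
      obtain ⟨hv, hvw⟩ := h'
      by_cases hw : c w = z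
      · rcases hint v w hvw (hv.trans hw.symm) with rfl | rfl
        · refine Finset.mem_union_left _ (Finset.mem_union_left _ ?_)
          exact Finset.mem_image.2 ⟨v, by simp [cell, hv], rfl⟩
        · refine Finset.mem_union_left _ (Finset.mem_union_right _ ?_)
          exact Finset.mem_image.2 ⟨w, by simp [cell, hw], rfl⟩
      · exact Finset.mem_union_right _ (Finset.mem_filter.2 ⟨h, hw⟩)
    have h3 : out.card ≤ (H.neighborsIn S z).card := by
      apply Finset.card_le_card_of_injOn (fun q => c q.2)
      · rintro ⟨v, w⟩ h
        simp only [out, darts, cell, Finset.coe_filter, Finset.mem_sigma, Finset.mem_filter,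
          Finset.mem_univ, true_and, mem_neighborFinset, Set.mem_ofPred_eq] at h
        simp only [neighborsIn, S, Finset.coe_filter, Finset.mem_filter, Finset.mem_univ,
          true_and, Set.mem_ofPred_eq]
        exact ⟨hcc w, Ne.symm h.2, v, w, h.1.2, h.1.1, rfl⟩
      · rintro ⟨v, w⟩ h ⟨v', w'⟩ h' heq
        simp only [out, darts, cell, Finset.coe_filter, Finset.mem_sigma, Finset.mem_filter,
          Finset.mem_univ, true_and, mem_neighborFinset, Set.mem_ofPred_eq] at h h' heq
        obtain ⟨rfl, rfl⟩ := hcross v w v' w' h.1.2 h'.1.2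
          (by rw [h.1.1]; exact Ne.symm h.2) (h'.1.1.trans h.1.1.symm) heq.symm
        rfl
    have h4 := (Finset.card_le_card h2).trans (Finset.card_union_le _ _)
    have h5 := Finset.card_union_le (cell.image fun v => (⟨v, π v⟩ : Σ _ : V, V))
      (cell.image fun v => ⟨π v, v⟩)
    have h6 := Finset.card_image_le (s := cell) (f := fun v => (⟨v, π v⟩ : Σ _ : V, V))
    have h7 := Finset.card_image_le (s := cell) (f := fun v => (⟨π v, v⟩ : Σ _ : V, V))
    omega
  have hSne : S.Nonempty := ⟨c (Classical.arbitrary V), by simp [S, hcc]⟩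
  refine (H.hasCliqueMinorIn_of_two_pow_le_degree n S hSne hHdeg).of_contraction
    (c := c) ?_ ?_ ?_
  · intro z hz
    simpa [S] using hz
  · intro v
    obtain ⟨q, -, -, h⟩ := hwalk v
    exact ⟨q, h⟩
  · rintro z z' ⟨-, h⟩
    exact h

end LargeGirth

section Coloring

/-- A homomorphism to the odd cycle on `2 * k + 1` vertices, on the part of `G` inside `S`: the
colors of adjacent vertices differ by `k` or `-k`. -/
def SimpleGraph.IsOddCycleColoringOn {V : Type u} (G : SimpleGraph V) (k : ℕ) (S : Set V)
    (f : V → ZMod (2 * k + 1)) : Prop :=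
  ∀ u ∈ S, ∀ v ∈ S, G.Adj u v → f u - f v = k ∨ f u - f v = -k

lemma SimpleGraph.IsOddCycleColoringOn.isCircularColoring {V : Type u} {G : SimpleGraph V} {k : ℕ}
    {f : V → ZMod (2 * k + 1)} (hf : G.IsOddCycleColoringOn k Set.univ f) :
    G.IsCircularColoring (2 * k + 1) k := by
  refine ⟨f, fun u v huv => ?_⟩
  have h1 : ((k : ℕ) : ZMod (2 * k + 1)).val = k := ZMod.val_cast_of_lt (by omega)
  rcases hf u trivial v trivial huv with h | h
  · rw [h, h1]
    omega
  · by_cases hk : k = 0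
    · subst hk
      have := ZMod.val_lt (f u - f v)
      omega
    · have h2 : (-(k : ZMod (2 * k + 1))) = ((k + 1 : ℕ) : ZMod (2 * k + 1)) := by
        have h3 : ((2 * k + 1 : ℕ) : ZMod (2 * k + 1)) = 0 := ZMod.natCast_self _
        push_cast at h3 ⊢
        linear_combination -h3
      rw [h, h2, ZMod.val_cast_of_lt (by omega)]
      omega

/-- Any two vertices of the odd cycle on `2 * k + 1` vertices are joined by a walk of
length `2 * k`. -/
lemma exists_oddCycle_seq (k : ℕ) (a b : ZMod (2 * k + 1)) :
    ∃ y : ℕ → ZMod (2 * k + 1), y 0 = a ∧ y (2 * k) = b ∧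
      ∀ i, y i - y (i + 1) = k ∨ y i - y (i + 1) = -k := by
  have h3 : ((2 * k + 1 : ℕ) : ZMod (2 * k + 1)) = 0 := ZMod.natCast_self _
  push_cast at h3
  set j := (a + k - b).val with hj
  have hjle : j ≤ 2 * k := Nat.lt_succ_iff.1 (ZMod.val_lt _)
  have hjc : (j : ZMod (2 * k + 1)) = a + k - b := by rw [hj, ZMod.natCast_val, ZMod.cast_id]
  refine ⟨fun i => a + (2 * (min i j : ℕ) - i) * k, by simp, ?_, ?_⟩
  · simp only [min_eq_right hjle, hjc]
    push_cast
    linear_combination (a - b) * h3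
  · intro i
    rcases lt_or_ge i j with h | h
    · right
      simp only [min_eq_left h.le, min_eq_left (Nat.succ_le_of_lt h)]
      push_cast
      ring
    · left
      simp only [min_eq_right h, min_eq_right (h.trans (Nat.le_succ i))]
      push_cast
      ring

variable {V : Type u} {G : SimpleGraph V}

lemma SimpleGraph.HasCliqueMinorIn.of_induce {s : Set V} {n : ℕ}
    (h : (G.induce s).HasCliqueMinorIn Set.univ n) : G.HasCliqueMinorIn Set.univ n := by
  obtain ⟨A, h1, h2, -, h4⟩ := h
  refine ⟨fun i => Subtype.val '' A i, ?_, ?_, fun i => Set.subset_univ _, ?_⟩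
  · intro i j hij
    exact (Set.disjoint_image_iff Subtype.val_injective).2 (h1 hij)
  · intro i
    let φ : (G.induce s).induce (A i) →g G.induce (Subtype.val '' A i) :=
      { toFun := fun x => ⟨x.1.1, x.1, x.2, rfl⟩
        map_rel' := fun h => h }
    refine (h2 i).map φ ?_
    rintro ⟨_, x, hx, rfl⟩
    exact ⟨⟨x, hx⟩, rfl⟩
  · intro i j hij
    obtain ⟨a, ha, b, hb, hab⟩ := h4 i j hij
    exact ⟨a, ⟨a, ha, rfl⟩, b, ⟨b, hb, rfl⟩, hab⟩

/-- A coloring of the complement of a vertex of degree at most one extends. -/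
lemma SimpleGraph.IsOddCycleColoringOn.exists_extend_leaf {k : ℕ} {v y : V}
    {f : V → ZMod (2 * k + 1)} (hf : G.IsOddCycleColoringOn k {v}ᶜ f)
    (hv : ∀ w, G.Adj v w → w = y) : ∃ f', G.IsOddCycleColoringOn k Set.univ f' := by
  classical
  refine ⟨Function.update f v (f y + k), ?_⟩
  intro u _ w _ huw
  by_cases hu : u = v
  · subst hu
    obtain rfl := hv w huw
    left
    rw [Function.update_self, Function.update_of_ne huw.ne']
    ring
  · by_cases hw : w = v
    · subst hw
      obtain rfl := hv u huw.symm
      right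
      rw [Function.update_self, Function.update_of_ne hu]
      ring
    · rw [Function.update_of_ne hu, Function.update_of_ne hw]
      exact hf u hu w hw huw

/-- A coloring of the complement of the interior of a path of length `2 * k`, all of whose
interior vertices have degree two, extends. -/
lemma SimpleGraph.IsOddCycleColoringOn.exists_extend_path {k : ℕ} {x : ℕ → V}
    {f : V → ZMod (2 * k + 1)}
    (hf : G.IsOddCycleColoringOn k {v | ∃ i, 0 < i ∧ i < 2 * k ∧ x i = v}ᶜ f)
    (hinj : ∀ i j, i < j → j ≤ 2 * k → x i ≠ x j)
    (hnbr : ∀ i, 0 < i → i < 2 * k → ∀ w, G.Adj (x i) w → w = x (i - 1) ∨ w = x (i + 1)) :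
    ∃ f', G.IsOddCycleColoringOn k Set.univ f' := by
  classical
  obtain ⟨y, hy0, hyk, hy⟩ := exists_oddCycle_seq k (f (x 0)) (f (x (2 * k)))
  have hinj' : ∀ i j, i ≤ 2 * k → j ≤ 2 * k → x i = x j → i = j := by
    intro i j hi hj h
    rcases lt_trichotomy i j with h' | h' | h'
    · exact absurd h (hinj i j h' hj)
    · exact h'
    · exact absurd h.symm (hinj j i h' hi)
  let f' : V → ZMod (2 * k + 1) := fun v =>
    if h : ∃ i, 0 < i ∧ i < 2 * k ∧ x i = v then y h.choose else f v
  have hout : ∀ v, (¬ ∃ i, 0 < i ∧ i < 2 * k ∧ x i = v) → f' v = f v := fun v h => dif_neg h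
  have hin : ∀ i, i ≤ 2 * k → f' (x i) = y i := by
    intro i hi
    by_cases h : ∃ j, 0 < j ∧ j < 2 * k ∧ x j = x i
    · have h1 : f' (x i) = y h.choose := dif_pos h
      obtain ⟨h2, h3, h4⟩ := h.choose_spec
      rw [h1, hinj' _ _ h3.le hi h4]
    · rw [hout _ h]
      by_cases h0 : i = 0
      · rw [h0, hy0]
      · by_cases h1 : i = 2 * k
        · rw [h1, hyk]
        · exact absurd ⟨i, by omega, by omega, rfl⟩ h
  have hint : ∀ i, 0 < i → i < 2 * k → ∀ w, G.Adj (x i) w →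
      f' (x i) - f' w = k ∨ f' (x i) - f' w = -k := by
    intro i h0 h1 w hw
    rcases hnbr i h0 h1 w hw with rfl | rfl
    · rw [hin i h1.le, hin (i - 1) (by omega)]
      have := hy (i - 1)
      rw [Nat.sub_add_cancel h0] at this
      rcases this with h | h
      · right
        linear_combination -h
      · left
        linear_combination -h
    · rw [hin i h1.le, hin (i + 1) (by omega)]
      exact hy i
  refine ⟨f', ?_⟩
  intro u _ w _ huw
  by_cases hu : ∃ i, 0 < i ∧ i < 2 * k ∧ x i = u
  · obtain ⟨i, h0, h1, rfl⟩ := hu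
    exact hint i h0 h1 w huw
  · by_cases hw : ∃ i, 0 < i ∧ i < 2 * k ∧ x i = w
    · obtain ⟨i, h0, h1, rfl⟩ := hw
      rcases hint i h0 h1 u huw.symm with h | h
      · right
        linear_combination -h
      · left
        linear_combination -h
    · rw [hout u hu, hout w hw]
      exact hf u hu w hw huw

/-- Graphs of large girth without a `K_n` minor map to the odd cycle on `2 * k + 1` vertices. -/
theorem SimpleGraph.exists_isOddCycleColoringOn (n k : ℕ) (hk : 0 < k) [Fintype V]
    (G : SimpleGraph V) (hG : ¬ G.HasCliqueMinorIn Set.univ n)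
    (hg : ((8 * (2 ^ n * (2 * k)) + 2 : ℕ) : ℕ∞) < G.egirth) :
    ∃ f, G.IsOddCycleColoringOn k Set.univ f := by
  classical
  induction hm : Fintype.card V using Nat.strong_induction_on generalizing V with
  | _ m ih =>
  have hsub : ∀ s : Set V, (∃ v, v ∉ s) → ∃ f, G.IsOddCycleColoringOn k s f := by
    rintro s ⟨v, hv⟩
    obtain ⟨f, hf⟩ := ih (Fintype.card s) (hm ▸ Fintype.card_subtype_lt hv) (G.induce s)
      (fun h => hG h.of_induce)
      (hg.trans_le (IsContained.egirth_le ⟨(Embedding.induce s).toCopy⟩)) rfl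
    refine ⟨fun v => if h : v ∈ s then f ⟨v, h⟩ else 0, ?_⟩
    intro u hu w hw huw
    simp only [hu, hw, dif_pos]
    exact hf ⟨u, hu⟩ trivial ⟨w, hw⟩ trivial huw
  by_cases hdeg : ∀ v, 2 ≤ G.degree v
  · rcases isEmpty_or_nonempty V with hV | hV
    · exact ⟨fun _ => 0, fun u => isEmptyElim u⟩
    · by_contra hcol
      refine hG (hasCliqueMinorIn_of_lt_egirth n (2 * k) hdeg ?_ hg)
      intro x hx hnb
      by_contra! hlow
      apply hcol
      obtain ⟨f, hf⟩ := hsub {v | ∃ i, 0 < i ∧ i < 2 * k ∧ x i = v}ᶜ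
        ⟨x 1, fun h => h ⟨1, by omega, by omega, rfl⟩⟩
      refine hf.exists_extend_path ?_ ?_
      · intro i j hij hj
        have hpos : 1 * (2 * k) ≤ 2 ^ n * (2 * k) := Nat.mul_le_mul_right _ Nat.one_le_two_pow
        have := seq_ne_of_lt_egirth x hx hnb (j - i) (by omega)
          (lt_of_le_of_lt (by exact_mod_cast (by omega)) hg) i
        rwa [show i + (j - i) = j by omega] at this
      · intro i h0 h1 w hw
        by_contra! hne
        have h2 := hlow i h0 h1
        have h3 : ({x (i - 1), x (i + 1), w} : Finset V) ⊆ G.neighborFinset (x i) := by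
          intro u hu
          simp only [Finset.mem_insert, Finset.mem_singleton] at hu
          rw [mem_neighborFinset]
          rcases hu with rfl | rfl | rfl
          · have := hx (i - 1)
            rw [Nat.sub_add_cancel h0] at this
            exact this.symm
          · exact hx i
          · exact hw
        have h4 : ({x (i - 1), x (i + 1), w} : Finset V).card = 3 := by
          refine Finset.card_eq_three.2 ⟨_, _, _, ?_, hne.1.symm, hne.2.symm, rfl⟩
          have := hnb (i - 1)
          rw [show i - 1 + 2 = i + 1 by omega] at this
          exact this.symm
        have h5 := Finset.card_le_card h3
        rw [h4, card_neighborFinset_eq_degree] at h5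
        omega
  · push Not at hdeg
    obtain ⟨v, hv⟩ := hdeg
    obtain ⟨f, hf⟩ := hsub {v}ᶜ ⟨v, by simp⟩
    have hy : ∃ y, ∀ w, G.Adj v w → w = y := by
      by_cases hw : ∃ w, G.Adj v w
      · obtain ⟨y, hy⟩ := hw
        refine ⟨y, fun w hw => ?_⟩
        rw [← card_neighborFinset_eq_degree] at hv
        exact Finset.card_le_one.1 (Nat.lt_succ_iff.1 hv) w (by simpa using hw) y (by simpa using hy)
      · exact ⟨v, fun w h => absurd ⟨w, h⟩ hw⟩
    obtain ⟨y, hy⟩ := hy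
    exact hf.exists_extend_leaf hy

end Coloring

theorem galluccio_goddyn_hell
    (n : ℕ) (hn : 4 ≤ n) (ε : ℝ) (hε : 0 < ε) :
    ∃ g : ℕ, ∀ (V : Type) [Fintype V] (G : SimpleGraph V),
      ¬ G.IsMinor (⊤ : SimpleGraph (Fin n)) → (g : ℕ∞) ≤ G.egirth →
      G.circChromNum ≤ 2 + ε := by
  obtain ⟨m, hm⟩ := exists_nat_one_div_lt hε
  refine ⟨8 * (2 ^ n * (2 * (m + 1))) + 2 + 1, fun V _ G hG hg => ?_⟩
  have hG' : ¬ G.HasCliqueMinorIn Set.univ n := by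
    rintro ⟨A, h1, h2, -, h4⟩
    exact hG ⟨A, h1, h2, fun i j hij => h4 i j hij⟩
  obtain ⟨f, hf⟩ := G.exists_isOddCycleColoringOn n (m + 1) m.succ_pos hG'
    (lt_of_lt_of_le (by exact_mod_cast Nat.lt_succ_self _) hg)
  have hle : G.circChromNum ≤ ((2 * (m + 1) + 1 : ℕ) : ℝ) / ((m + 1 : ℕ) : ℝ) := by
    refine csInf_le ⟨0, ?_⟩ ⟨_, _, Nat.succ_pos _, m.succ_pos, hf.isCircularColoring, rfl⟩
    rintro x ⟨a, b, -, -, -, rfl⟩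
    positivity
  refine hle.trans ?_
  have h1 : ((2 * (m + 1) + 1 : ℕ) : ℝ) / ((m + 1 : ℕ) : ℝ) = 2 + 1 / ((m : ℝ) + 1) := by
    push_cast
    field_simp
  rw [h1]
  linarith
end
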